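/- arXiv:math/0402462 — 16 statements merged into one kernel-verified Lean document; each statement's English description precedes it below -/
import Mathlib

section
/- Let (a_n)_{n≥1}, (b_n)_{n≥1} and (G_n)_{n≥-1} be sequences of real numbers such that a_n ≠ 0 for all n ≥ 1 and G_n = a_n·G_{n-2} + b_n·G_{n-1} for all n ≥ 1, and suppose G_{-1} ≠ 0. Let B_n denote the canonical denominators of the continued fraction K_{n=1}^∞ (a_n/b_n), and assume B_n ≠ 0 for all n ≥ 1. If G_n/B_n → 0 as n → ∞, then the approximants A_n/B_n converge and their limit is −G_0/G_{-1}. -/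
open Filter Topology Polynomial

/-- Canonical numerators `A` of the continued fraction `b₀ + K(aₙ/bₙ)`,
shifted so that `cfA b₀ a b (n+1) = A_n` (and `cfA b₀ a b 0 = A_{-1} = 1`). -/
noncomputable def cfA (b₀ : ℝ) (a b : ℕ → ℝ) : ℕ → ℝ
  | 0 => 1
  | 1 => b₀
  | n + 2 => b (n + 1) * cfA b₀ a b (n + 1) + a (n + 1) * cfA b₀ a b n

/-- Canonical denominators `B` of the continued fraction `b₀ + K(aₙ/bₙ)`,
shifted so that `cfB b₀ a b (n+1) = B_n` (and `cfB b₀ a b 0 = B_{-1} = 0`). -/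
noncomputable def cfB (b₀ : ℝ) (a b : ℕ → ℝ) : ℕ → ℝ
  | 0 => 0
  | 1 => 1
  | n + 2 => b (n + 1) * cfB b₀ a b (n + 1) + a (n + 1) * cfB b₀ a b n

/-- A solution of the three-term recurrence is the combination of the canonical numerators and
denominators determined by its first two values. -/
theorem eq_mul_cfA_add_mul_cfB {a b G : ℕ → ℝ}
    (hG : ∀ n : ℕ, 1 ≤ n → G (n + 1) = a n * G (n - 1) + b n * G n) (n : ℕ) :
    G n = G 0 * cfA 0 a b n + G 1 * cfB 0 a b n := by
  induction n using Nat.twoStepInduction with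
  | zero => simp [cfA, cfB]
  | one => simp [cfA, cfB]
  | more n ih₀ ih₁ =>
    have h := hG (n + 1) (by omega)
    rw [Nat.add_sub_cancel, ih₀, ih₁] at h
    rw [h, cfA, cfB]
    ring

theorem pincherle (a b G : ℕ → ℝ)
    (ha : ∀ n : ℕ, 1 ≤ n → a n ≠ 0)
    (hG : ∀ n : ℕ, 1 ≤ n → G (n + 1) = a n * G (n - 1) + b n * G n)
    (hGneg : G 0 ≠ 0)
    (hB : ∀ n : ℕ, 1 ≤ n → cfB 0 a b (n + 1) ≠ 0)
    (hlim : Tendsto (fun n : ℕ => G (n + 1) / cfB 0 a b (n + 1)) atTop (nhds 0)) :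
    Tendsto (fun n : ℕ => cfA 0 a b (n + 1) / cfB 0 a b (n + 1)) atTop
      (nhds (-(G 1 / G 0))) := by
  have hlim' := (hlim.div_const (G 0)).sub_const (G 1 / G 0)
  rw [zero_div, zero_sub] at hlim'
  refine hlim'.congr' ?_
  filter_upwards [eventually_ge_atTop 1] with n hn
  have hBn := hB n hn
  rw [eq_mul_cfA_add_mul_cfB hG (n + 1)]
  field_simp
  ring
end

section
/- Let H : {n ∈ ℤ : n ≥ -1} → ℝ and b : {n ∈ ℤ : n ≥ 1} → ℝ be given by rational functions, i.e., there are real polynomials p, q with q(n) ≠ 0 and H_n = p(n)/q(n) for all integers n ≥ -1, and real polynomials u, v with v(n) ≠ 0 and b_n = u(n)/v(n) for all integers n ≥ 1. Assume H_n > 0 for all n ≥ -1, b_n > 0 for all n ≥ 1, and that either deg u > deg v, or deg u = deg v and the quotient of the leading coefficient of u by the leading coefficient of v is greater than 1. Then the continued fraction K_{n=1}^∞ (a_n/b_n) with partial numerators a_n = (H_n + b_n·H_{n-1})/H_{n-2} converges, and its limit is H_0/H_{-1}. -/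
open Filter Topology Polynomial

/-- The shifted quotient of a nonzero polynomial tends to `1` at infinity. -/
theorem Polynomial.tendsto_eval_div_eval_add_one {p : ℝ[X]} (hp : p ≠ 0) :
    Tendsto (fun x : ℝ => p.eval x / p.eval (x + 1)) atTop (𝓝 1) := by
  have h := div_tendsto_atTop_leadingCoeff_div_of_degree_eq p (taylor 1 p) (degree_taylor p 1).symm
  simpa [taylor_eval, add_comm, hp] using h

/-- A sequence that eventually gains at least `δ > 0` over every two steps tends to infinity. -/
theorem tendsto_atTop_of_add_le_add_two {r : ℕ → ℝ} {δ : ℝ} (hδ : 0 < δ) {N : ℕ}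
    (hr : ∀ n, 0 ≤ r n) (h : ∀ n, N ≤ n → r n + δ ≤ r (n + 2)) : Tendsto r atTop atTop := by
  have key : ∀ k n, N + 2 * k ≤ n → k * δ ≤ r n := by
    intro k
    induction k with
    | zero => intro n _; simpa using hr n
    | succ k ih =>
      intro n hn
      obtain ⟨m, rfl⟩ : ∃ m, n = m + 2 := ⟨n - 2, by omega⟩
      have h₁ := ih m (by omega)
      have h₂ := h m (by omega)
      push_cast
      linarith
  refine tendsto_atTop.2 fun C => ?_
  obtain ⟨k, hk⟩ := exists_nat_gt (C / δ)
  filter_upwards [eventually_ge_atTop (N + 2 * k)] with n hn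
  exact ((div_lt_iff₀ hδ).1 hk).le.trans (key k n hn)

/-- If `0 ≤ r`, `r 1 > 0` and `r (n + 2) = c n * r (n + 1) + (1 + c n) * r n` with nonnegative `c`
that is eventually bounded away from zero, then `r` tends to infinity. -/
theorem tendsto_atTop_of_linear_recurrence {r c : ℕ → ℝ} (h₀ : 0 ≤ r 0) (h₁ : 0 < r 1)
    (hc : ∀ n, 0 ≤ c n) {ε : ℝ} (hε : 0 < ε) (hcε : ∀ᶠ n in atTop, ε ≤ c n)
    (hrec : ∀ n, r (n + 2) = c n * r (n + 1) + (1 + c n) * r n) : Tendsto r atTop atTop := by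
  have hr : ∀ n, 0 ≤ r n ∧ 0 ≤ r (n + 1) := by
    intro n
    induction n with
    | zero => exact ⟨h₀, h₁.le⟩
    | succ n ih =>
      refine ⟨ih.2, ?_⟩
      rw [hrec]
      have := hc n
      have := ih.1
      have := ih.2
      positivity
  have hs : ∀ n, r 1 ≤ r n + r (n + 1) := by
    intro n
    induction n with
    | zero => simpa using h₀
    | succ n ih =>
      rw [hrec]
      nlinarith [hc n, hr n]
  obtain ⟨N, hN⟩ := eventually_atTop.1 hcε
  refine tendsto_atTop_of_add_le_add_two (mul_pos hε h₁) (fun n => (hr n).1) (N := N) fun n hn => ?_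
  have := mul_le_mul (hN n hn) (hs n) h₁.le (hc n)
  rw [hrec]
  linarith

/-- A rational sequence with positive values, whose numerator has larger degree than its
denominator or the same degree and leading quotient greater than `1`, is eventually at least `1`. -/
theorem eventually_one_le_of_degree {u v : ℝ[X]} {b : ℕ → ℝ} (hv : v ≠ 0)
    (hb : ∀ n : ℕ, 1 ≤ n → b n = u.eval (n : ℝ) / v.eval (n : ℝ))
    (hbpos : ∀ n : ℕ, 1 ≤ n → 0 < b n)
    (hdeg : v.degree < u.degree ∨
      (u.degree = v.degree ∧ 1 < u.leadingCoeff / v.leadingCoeff)) :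
    ∀ᶠ n in atTop, 1 ≤ b n := by
  rcases hdeg with h | ⟨h, hlc⟩
  · have ht := (abs_div_tendsto_atTop_atTop_of_degree_gt u v h hv).comp
      (tendsto_natCast_atTop_atTop (R := ℝ))
    filter_upwards [ht.eventually_ge_atTop 1, eventually_ge_atTop 1] with n hn hn1
    rw [Function.comp_apply, ← hb n hn1, abs_of_pos (hbpos n hn1)] at hn
    exact hn
  · have ht := (div_tendsto_atTop_leadingCoeff_div_of_degree_eq u v h).comp
      (tendsto_natCast_atTop_atTop (R := ℝ))
    filter_upwards [ht.eventually_const_le hlc, eventually_ge_atTop 1] with n hn hn1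
    rwa [Function.comp_apply, ← hb n hn1] at hn

/-- Consecutive values of a positive rational sequence have quotient tending to `1`. -/
theorem tendsto_rational_div_succ {p q : ℝ[X]} {H : ℕ → ℝ}
    (hH : ∀ m : ℕ, H m = p.eval ((m : ℝ) - 1) / q.eval ((m : ℝ) - 1)) (hH₀ : H 0 ≠ 0) :
    Tendsto (fun n => H (n + 1) / H (n + 2)) atTop (𝓝 1) := by
  have hp : p ≠ 0 := by
    rintro rfl
    exact hH₀ (by simp [hH])
  have hq : q ≠ 0 := by
    rintro rfl
    exact hH₀ (by simp [hH])
  have h := ((tendsto_eval_div_eval_add_one hp).div (tendsto_eval_div_eval_add_one hq)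
    one_ne_zero).comp (tendsto_natCast_atTop_atTop (R := ℝ))
  rw [div_one] at h
  refine h.congr fun n => ?_
  have e : ((n + 2 : ℕ) : ℝ) - 1 = n + 1 := by push_cast; ring
  have e' : ((n + 1 : ℕ) : ℝ) - 1 = n := by push_cast; ring
  rw [hH, hH, e, e', div_div_div_comm]
  rfl

/-- If `(-1) ^ n * H n` solves the three-term recurrence of a continued fraction, then it is the
combination of canonical numerators and denominators determined by its initial values. -/
theorem neg_one_pow_mul_eq_cfA_cfB {a b H : ℕ → ℝ}
    (h : ∀ n, H (n + 2) = a (n + 1) * H n - b (n + 1) * H (n + 1)) (n : ℕ) :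
    (-1) ^ n * H n = H 0 * cfA 0 a b n - H 1 * cfB 0 a b n := by
  induction n using Nat.twoStepInduction with
  | zero => simp [cfA, cfB]
  | one => simp [cfA, cfB]
  | more n ih ih' =>
    simp only [cfA, cfB, h, pow_succ] at ih' ⊢
    linear_combination a (n + 1) * ih + b (n + 1) * ih'

theorem pinch_prop (p q u v : Polynomial ℝ) (H b a : ℕ → ℝ)
    (hq : ∀ m : ℕ, q.eval ((m : ℝ) - 1) ≠ 0)
    (hH : ∀ m : ℕ, H m = p.eval ((m : ℝ) - 1) / q.eval ((m : ℝ) - 1))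
    (hv : ∀ n : ℕ, 1 ≤ n → v.eval (n : ℝ) ≠ 0)
    (hb : ∀ n : ℕ, 1 ≤ n → b n = u.eval (n : ℝ) / v.eval (n : ℝ))
    (hHpos : ∀ m : ℕ, 0 < H m)
    (hbpos : ∀ n : ℕ, 1 ≤ n → 0 < b n)
    (hdeg : v.degree < u.degree ∨
      (u.degree = v.degree ∧ 1 < u.leadingCoeff / v.leadingCoeff))
    (haval : ∀ n : ℕ, 1 ≤ n → a n = (H (n + 1) + b n * H n) / H (n - 1)) :
    Tendsto (fun n : ℕ => cfA 0 a b (n + 1) / cfB 0 a b (n + 1)) atTop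
      (nhds (H 1 / H 0)) := by
  have hv₀ : v ≠ 0 := by
    rintro rfl
    exact hv 1 le_rfl (by simp)
  have ha : ∀ n, a (n + 1) * H n = H (n + 2) + b (n + 1) * H (n + 1) := fun n => by
    rw [haval (n + 1) (by omega), Nat.add_sub_cancel, div_mul_cancel₀ _ (hHpos n).ne']
  have hHb : ∀ᶠ n in atTop, 1 / 2 ≤ b (n + 1) * (H (n + 1) / H (n + 2)) := by
    filter_upwards [(tendsto_rational_div_succ hH (hHpos 0).ne').eventually_const_le
      (show (1 / 2 : ℝ) < 1 by norm_num),
      (tendsto_add_atTop_nat 1).eventually (eventually_one_le_of_degree hv₀ hb hbpos hdeg)]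
      with n h₁ h₂
    nlinarith
  have hr : Tendsto (fun n => cfB 0 a b n / H n) atTop atTop := by
    refine tendsto_atTop_of_linear_recurrence (c := fun n => b (n + 1) * (H (n + 1) / H (n + 2)))
      (by simp [cfB]) (by simpa [cfB] using hHpos 1)
      (fun n => (mul_pos (hbpos _ (by omega)) (div_pos (hHpos _) (hHpos _))).le)
      one_half_pos hHb fun n => ?_
    have h₀ := (hHpos n).ne'
    have h₁ := (hHpos (n + 1)).ne'
    have h₂ := (hHpos (n + 2)).ne'
    simp only [cfB]
    field_simp
    linear_combination cfB 0 a b n * ha n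
  have hr₁ := hr.comp (tendsto_add_atTop_nat 1)
  have hsmall : Tendsto (fun n : ℕ => (-1 : ℝ) ^ (n + 1) * (cfB 0 a b (n + 1) / H (n + 1))⁻¹)
      atTop (𝓝 0) := by
    refine squeeze_zero_norm (fun n => ?_) (by simpa using hr₁.inv_tendsto_atTop.norm)
    simp
  have hlim := (hsmall.div_const (H 0)).add_const (H 1 / H 0)
  rw [zero_div, zero_add] at hlim
  refine hlim.congr' ?_
  filter_upwards [hr₁.eventually_gt_atTop 0] with n hn
  have h₀ := (hHpos 0).ne'
  have h₁ := (hHpos (n + 1)).ne'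
  have hB : cfB 0 a b (n + 1) ≠ 0 := by
    intro h
    simp [h] at hn
  have h := neg_one_pow_mul_eq_cfA_cfB (a := a) (b := b) (H := H)
    (fun n => by linear_combination -ha n) (n + 1)
  field_simp
  linear_combination h
end

section
/- Let f, g, c, d be real polynomials such that f(n) and g(n) are nonzero and have the same sign for every integer n ≥ -1, c(n) and d(n) are nonzero and have the same sign for every integer n ≥ 0, and either deg c > deg d, or deg c = deg d and the leading coefficient of c is greater than the leading coefficient of d. Write f_n = f(n), etc. Then the continued fraction with partial numerators and denominators a_1 = g_{-1}(d_1 f_1 g_0 + c_1 f_0 g_1), b_1 = c_1 f_{-1} g_0 g_1; a_2 = d_1 f_{-1} g_0^2 (d_2 f_2 g_1 + c_2 f_1 g_2), b_2 = c_2 f_0 g_2; and for n ≥ 3, a_n = d_{n-1} f_{n-3} g_{n-2} (d_n f_n g_{n-1} + c_n f_{n-1} g_n), b_n = c_n f_{n-2} g_n, converges, and its limit is f_0·g_{-1}/(g_0·f_{-1}). -/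
open Filter Topology Polynomial

/-- If `r n * (b (n + 1) + r (n + 1)) = a (n + 1)`, so that `r` is a sequence of right tails of
`K(aₙ/bₙ)`, and the ratios `b n / r n` are positive and eventually bounded away from zero, then the
continued fraction converges to `r 0`. -/
theorem tendsto_cfA_div_cfB_of_tails (a b r : ℕ → ℝ) (hr : ∀ n, r n ≠ 0)
    (hrec : ∀ n, r n * (b (n + 1) + r (n + 1)) = a (n + 1))
    (hpos : ∀ n, 0 < b (n + 1) / r (n + 1))
    {δ : ℝ} (hδ : 0 < δ) (hlow : ∀ᶠ n in atTop, δ ≤ b (n + 1) / r (n + 1)) :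
    Tendsto (fun n : ℕ => cfA 0 a b (n + 1) / cfB 0 a b (n + 1)) atTop (𝓝 (r 0)) := by
  set R : ℕ → ℝ := fun n => ∏ k ∈ Finset.range n, r (k + 1) with hR
  have hR0 : ∀ n, R n ≠ 0 := fun n => Finset.prod_ne_zero_iff.2 fun k _ => hr _
  have hRs : ∀ n, R (n + 1) = R n * r (n + 1) := fun n => Finset.prod_range_succ _ _
  have hminimal : ∀ n, cfA 0 a b (n + 1) - r 0 * cfB 0 a b (n + 1) = (-1) ^ (n + 1) * r 0 * R n ∧
      cfA 0 a b (n + 2) - r 0 * cfB 0 a b (n + 2) = (-1) ^ (n + 2) * r 0 * R (n + 1) := by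
    intro n
    induction n with
    | zero =>
      have h := hrec 0
      simp only [zero_add] at h
      refine ⟨by simp [cfA, cfB, hR], ?_⟩
      simp only [cfA, cfB, hR, zero_add, Finset.prod_range_one, ← h]
      ring
    | succ n ih =>
      refine ⟨ih.2, ?_⟩
      have e : cfA 0 a b (n + 1 + 2) - r 0 * cfB 0 a b (n + 1 + 2) =
          b (n + 2) * (cfA 0 a b (n + 2) - r 0 * cfB 0 a b (n + 2)) +
          a (n + 2) * (cfA 0 a b (n + 1) - r 0 * cfB 0 a b (n + 1)) := by
        simp only [cfA, cfB]
        ring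
      rw [e, ih.1, ih.2, ← hrec (n + 1), hRs (n + 1), hRs n]
      ring
  set y : ℕ → ℝ := fun n => cfB 0 a b (n + 1) / R n with hy
  have hy0 : y 0 = 1 := by simp [hy, hR, cfB]
  have hy1 : y 1 = b 1 / r 1 := by simp [hy, hR, cfB]
  have hys : ∀ n, y (n + 2) = y n + b (n + 2) / r (n + 2) * (y (n + 1) + y n) := by
    intro n
    have e : cfB 0 a b (n + 2 + 1) =
        b (n + 2) * cfB 0 a b (n + 2) + a (n + 2) * cfB 0 a b (n + 1) := by
      simp only [cfB]
    have h1 := hR0 n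
    have h2 := hr (n + 1)
    have h3 := hr (n + 2)
    simp only [hy]
    rw [e, ← hrec (n + 1), hRs (n + 1), hRs n]
    field_simp
    ring
  have hypos : ∀ n, 0 < y n ∧ 0 < y (n + 1) ∧ 1 ≤ y (n + 1) + y n := by
    intro n
    induction n with
    | zero =>
      have h := hpos 0
      simp only [zero_add] at h ⊢
      rw [hy0, hy1]
      exact ⟨one_pos, h, by linarith⟩
    | succ n ih =>
      obtain ⟨h1, h2, h3⟩ := ih
      have h := mul_pos (hpos (n + 1)) (by linarith : 0 < y (n + 1) + y n)
      have e := hys n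
      exact ⟨h2, by linarith, by linarith⟩
  obtain ⟨N, hN⟩ := eventually_atTop.1 hlow
  have hstep : ∀ n, N ≤ n → y n + δ ≤ y (n + 2) := by
    intro n hn
    rw [hys n]
    have h := hN (n + 1) (by omega)
    nlinarith [(hypos n).2.2, hpos (n + 1)]
  have hgrow : ∀ m : ℕ, δ * ((m - 1) / 2) ≤ y (m + N) ∧
      δ * (((m + 1 : ℕ) - 1) / 2) ≤ y (m + 1 + N) := by
    intro m
    induction m with
    | zero =>
      have h1 := (hypos (0 + N)).1
      have h2 := (hypos (0 + 1 + N)).1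
      push_cast
      constructor <;> linarith
    | succ m ih =>
      refine ⟨ih.2, ?_⟩
      have h := hstep (m + N) (by omega)
      rw [show m + 1 + 1 + N = m + N + 2 by ring]
      push_cast
      linarith [ih.1]
  have hytop : Tendsto y atTop atTop := by
    rw [← tendsto_add_atTop_iff_nat N]
    refine tendsto_atTop_mono (fun m => (hgrow m).1) ?_
    refine Tendsto.const_mul_atTop hδ (Tendsto.atTop_div_const two_pos ?_)
    exact tendsto_atTop_add_const_right _ (-1) tendsto_natCast_atTop_atTop
  have hquot : ∀ n, cfA 0 a b (n + 1) / cfB 0 a b (n + 1) =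
      r 0 + (-1) ^ (n + 1) * r 0 * (y n)⁻¹ := by
    intro n
    have h1 := hR0 n
    have h2 : cfB 0 a b (n + 1) ≠ 0 := fun h => (hypos n).1.ne' (by simp [hy, h])
    have h3 := (hminimal n).1
    simp only [hy]
    field_simp
    linarith
  simp only [hquot]
  have herr : Tendsto (fun n => (-1) ^ (n + 1) * r 0 * (y n)⁻¹) atTop (𝓝 0) := by
    refine squeeze_zero_norm (a := fun n => |r 0| * (y n)⁻¹) (fun n => ?_) ?_
    · have h := (hypos n).1
      simp [abs_of_pos h]
    · simpa using (tendsto_inv_atTop_zero.comp hytop).const_mul |r 0|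
  simpa using herr.const_add (r 0)

/-- The two products have leading terms of comparable size when `d.degree ≤ c.degree`. -/
theorem exists_pos_eventually_mul_abs_le (f g c d : Polynomial ℝ) (h : d.degree ≤ c.degree) :
    ∃ δ : ℝ, 0 < δ ∧ ∀ᶠ x : ℝ in atTop,
      δ * |d.eval x * f.eval x * g.eval (x - 1)| ≤ |c.eval x * f.eval (x - 1) * g.eval x| := by
  have hO := Polynomial.isBigO_atTop_of_degree_le (P := d * f * taylor (-1) g)
    (Q := c * taylor (-1) f * g) (by
      simp only [degree_mul, degree_taylor]
      gcongr)
  obtain ⟨C, hC, hb⟩ := hO.exists_pos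
  refine ⟨C⁻¹, inv_pos.2 hC, hb.bound.mono fun x hx => ?_⟩
  rw [inv_mul_le_iff₀ hC]
  simpa [taylor_eval, sub_eq_add_neg, add_comm] using hx

theorem pinch_poly (f g c d : Polynomial ℝ) (a b : ℕ → ℝ)
    (hfg : ∀ m : ℤ, -1 ≤ m →
      f.eval (m : ℝ) ≠ 0 ∧ g.eval (m : ℝ) ≠ 0 ∧
        (0 < f.eval (m : ℝ) ↔ 0 < g.eval (m : ℝ)))
    (hcd : ∀ m : ℤ, 0 ≤ m →
      c.eval (m : ℝ) ≠ 0 ∧ d.eval (m : ℝ) ≠ 0 ∧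
        (0 < c.eval (m : ℝ) ↔ 0 < d.eval (m : ℝ)))
    (hdeg : d.degree < c.degree ∨
      (c.degree = d.degree ∧ d.leadingCoeff < c.leadingCoeff))
    (ha1 : a 1 = g.eval (-1) *
      (d.eval 1 * f.eval 1 * g.eval 0 + c.eval 1 * f.eval 0 * g.eval 1))
    (hb1 : b 1 = c.eval 1 * f.eval (-1) * g.eval 0 * g.eval 1)
    (ha2 : a 2 = d.eval 1 * f.eval (-1) * (g.eval 0) ^ 2 *
      (d.eval 2 * f.eval 2 * g.eval 1 + c.eval 2 * f.eval 1 * g.eval 2))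
    (hb2 : b 2 = c.eval 2 * f.eval 0 * g.eval 2)
    (han : ∀ n : ℕ, 3 ≤ n → a n =
      d.eval ((n : ℝ) - 1) * f.eval ((n : ℝ) - 3) * g.eval ((n : ℝ) - 2) *
        (d.eval (n : ℝ) * f.eval (n : ℝ) * g.eval ((n : ℝ) - 1) +
          c.eval (n : ℝ) * f.eval ((n : ℝ) - 1) * g.eval (n : ℝ)))
    (hbn : ∀ n : ℕ, 3 ≤ n → b n =
      c.eval (n : ℝ) * f.eval ((n : ℝ) - 2) * g.eval (n : ℝ)) :
    Tendsto (fun n : ℕ => cfA 0 a b (n + 1) / cfB 0 a b (n + 1)) atTop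
      (nhds (f.eval 0 * g.eval (-1) / (g.eval 0 * f.eval (-1)))) := by
  have hf : ∀ m : ℤ, -1 ≤ m → f.eval (m : ℝ) ≠ 0 := fun m hm => (hfg m hm).1
  have hg : ∀ m : ℤ, -1 ≤ m → g.eval (m : ℝ) ≠ 0 := fun m hm => (hfg m hm).2.1
  have hfm1 : f.eval (-1) ≠ 0 := by simpa using hf (-1) le_rfl
  have hgm1 : g.eval (-1) ≠ 0 := by simpa using hg (-1) le_rfl
  have hf0 : f.eval 0 ≠ 0 := by simpa using hf 0 (by norm_num)
  have hg0 : g.eval 0 ≠ 0 := by simpa using hg 0 (by norm_num)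
  have hfn : ∀ n : ℕ, f.eval (n : ℝ) ≠ 0 := fun n => by simpa using hf n (by omega)
  have hgn : ∀ n : ℕ, g.eval (n : ℝ) ≠ 0 := fun n => by simpa using hg n (by omega)
  have hdn : ∀ n : ℕ, d.eval (n : ℝ) ≠ 0 := fun n => by simpa using (hcd n (by omega)).2.1
  have hpos_div : ∀ {x z : ℝ}, x ≠ 0 → z ≠ 0 → (0 < x ↔ 0 < z) → 0 < x / z := by
    intro x z hx hz h
    rcases hz.lt_or_gt with hz' | hz'
    · exact div_pos_of_neg_of_neg (lt_of_le_of_ne (not_lt.1 fun hx' => hz'.not_gt (h.1 hx')) hx) hz'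
    · exact div_pos (h.2 hz') hz'
  have hu : ∀ n : ℕ, 0 < f.eval (n : ℝ) / g.eval (n : ℝ) := fun n => by
    obtain ⟨h1, h2, h3⟩ := hfg n (by omega)
    simpa using hpos_div h1 h2 h3
  have hq : ∀ n : ℕ, 0 < c.eval (n : ℝ) / d.eval (n : ℝ) := fun n => by
    obtain ⟨h1, h2, h3⟩ := hcd n (by omega)
    simpa using hpos_div h1 h2 h3
  let r : ℕ → ℝ
    | 0 => f.eval 0 * g.eval (-1) / (g.eval 0 * f.eval (-1))
    | 1 => d.eval 1 * f.eval (-1) * g.eval 0 ^ 2 * f.eval 1 / f.eval 0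
    | n + 2 => d.eval ((n + 2 : ℕ) : ℝ) * f.eval ((n + 2 : ℕ) : ℝ) * g.eval ((n + 1 : ℕ) : ℝ) *
        f.eval (n : ℝ) / f.eval ((n + 1 : ℕ) : ℝ)
  have hr : ∀ n, r n ≠ 0 := by
    have hd1 := hdn 1
    have hf1 := hfn 1
    rw [Nat.cast_one] at hd1 hf1
    rintro (_ | _ | n)
    · simp [r, *]
    · simp [r, *]
    · simp only [r]
      exact div_ne_zero (mul_ne_zero (mul_ne_zero (mul_ne_zero (hdn _) (hfn _)) (hgn _)) (hfn _))
        (hfn _)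
  have han' : ∀ n : ℕ, a (n + 3) =
      d.eval ((n + 2 : ℕ) : ℝ) * f.eval (n : ℝ) * g.eval ((n + 1 : ℕ) : ℝ) *
        (d.eval ((n + 3 : ℕ) : ℝ) * f.eval ((n + 3 : ℕ) : ℝ) * g.eval ((n + 2 : ℕ) : ℝ) +
          c.eval ((n + 3 : ℕ) : ℝ) * f.eval ((n + 2 : ℕ) : ℝ) * g.eval ((n + 3 : ℕ) : ℝ)) := by
    intro n
    rw [han (n + 3) (by omega), show ((n + 3 : ℕ) : ℝ) - 1 = (n + 2 : ℕ) by push_cast; ring,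
      show ((n + 3 : ℕ) : ℝ) - 2 = (n + 1 : ℕ) by push_cast; ring,
      show ((n + 3 : ℕ) : ℝ) - 3 = n by push_cast; ring]
  have hbn' : ∀ n : ℕ, b (n + 2) =
      c.eval ((n + 2 : ℕ) : ℝ) * f.eval (n : ℝ) * g.eval ((n + 2 : ℕ) : ℝ) := by
    rintro (_ | n)
    · simpa using hb2
    · rw [hbn (n + 1 + 2) (by omega),
        show ((n + 1 + 2 : ℕ) : ℝ) - 2 = (n + 1 : ℕ) by push_cast; ring]
  have hrec : ∀ n, r n * (b (n + 1) + r (n + 1)) = a (n + 1) := by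
    rintro (_ | _ | n)
    · simp only [r, zero_add, ha1, hb1]
      field_simp
      ring
    · have hf1 := hfn 1
      simp only [r, zero_add, Nat.reduceAdd, ha2, hb2, Nat.cast_one, Nat.cast_zero,
        Nat.cast_ofNat] at hf1 ⊢
      field_simp
      ring
    · have h1 := hfn (n + 1)
      have h2 := hfn (n + 2)
      simp only [r, han' n, hbn' (n + 1)]
      simp only [add_assoc, Nat.reduceAdd]
      field_simp
      ring
  have hratio : ∀ n : ℕ, b (n + 1) / r (n + 1) =
      c.eval ((n + 1 : ℕ) : ℝ) * f.eval (n : ℝ) * g.eval ((n + 1 : ℕ) : ℝ) /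
        (d.eval ((n + 1 : ℕ) : ℝ) * f.eval ((n + 1 : ℕ) : ℝ) * g.eval (n : ℝ)) := by
    rintro (_ | n)
    · have hd1 := hdn 1
      have hf1 := hfn 1
      simp only [r, zero_add, hb1, Nat.cast_one, Nat.cast_zero] at hd1 hf1 ⊢
      field_simp
    · have h0 := hfn n
      have h1 := hfn (n + 1)
      have h2 := hfn (n + 2)
      have h3 := hdn (n + 2)
      have h4 := hgn (n + 1)
      simp only [r, hbn' n, add_assoc, Nat.reduceAdd]
      field_simp
  have hpos : ∀ n, 0 < b (n + 1) / r (n + 1) := by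
    intro n
    rw [hratio n]
    have h := mul_pos (mul_pos (hq (n + 1)) (hu n)) (inv_pos.2 (hu (n + 1)))
    rwa [inv_div, div_mul_div_comm, div_mul_div_comm, mul_right_comm (d.eval _)] at h
  obtain ⟨δ, hδ, hlow⟩ := exists_pos_eventually_mul_abs_le f g c d
    (hdeg.elim le_of_lt fun h => h.1.ge)
  refine tendsto_cfA_div_cfB_of_tails a b r hr hrec hpos hδ ?_
  filter_upwards [(tendsto_natCast_atTop_atTop.comp (tendsto_add_atTop_nat 1)).eventually hlow]
    with n hn
  simp only [Function.comp_apply, show ((n + 1 : ℕ) : ℝ) - 1 = n by push_cast; ring] at hn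
  rw [← abs_of_pos (hpos n), hratio n, abs_div, le_div_iff₀ (abs_pos.2
    (mul_ne_zero (mul_ne_zero (hdn _) (hfn _)) (hgn _)))]
  exact hn
end

section
/- Let b be a (real) polynomial with b(n) ≥ 2 for all integers n ≥ 1, and write b_n = b(n). Then the continued fraction with partial numerators and denominators a_1 = 3 + 2b_1, d_1 = b_1, and for n ≥ 2, a_n = (n-1)(n + 2 + (n+1)b_n), d_n = n·b_n, converges and its limit is 2. -/
open Filter Topology Polynomial

theorem cfB_ge_two_pow_mul_factorial {b₀ : ℝ} {a d : ℕ → ℝ} (ha : ∀ n, 1 ≤ n → 0 ≤ a n)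
    (hd : ∀ n : ℕ, 1 ≤ n → 2 * (n : ℝ) ≤ d n) (n : ℕ) :
    (2 : ℝ) ^ n * (n.factorial : ℝ) ≤ cfB b₀ a d (n + 1) ∧ 0 ≤ cfB b₀ a d n := by
  induction n with
  | zero => simp [cfB]
  | succ n ih =>
    obtain ⟨h₁, h₀⟩ := ih
    have hpos : (0 : ℝ) ≤ 2 ^ n * (n.factorial : ℝ) := by positivity
    have ha' := mul_nonneg (ha (n + 1) (by lia)) h₀
    have hd' := hd (n + 1) (by lia)
    have hmul := mul_le_mul hd' h₁ hpos (le_trans (by positivity) hd')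
    refine ⟨?_, hpos.trans h₁⟩
    rw [cfB, Nat.factorial_succ, pow_succ]
    push_cast at hmul ⊢
    linarith

theorem cfA_sub_two_mul_cfB {a d β : ℕ → ℝ} (ha1 : a 1 = 3 + 2 * β 1)
    (han : ∀ n : ℕ, 2 ≤ n → a n = ((n : ℝ) - 1) * ((n : ℝ) + 2 + ((n : ℝ) + 1) * β n))
    (hdn : ∀ n : ℕ, 1 ≤ n → d n = (n : ℝ) * β n) (n : ℕ) :
    cfA 0 a d (n + 1) - 2 * cfB 0 a d (n + 1) =
      (-1) ^ (n + 1) * (((n : ℝ) + 2) * (n.factorial : ℝ)) := by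
  induction n using Nat.twoStepInduction with
  | zero => simp [cfA, cfB]
  | one =>
    simp [cfA, cfB, ha1, hdn 1 le_rfl]
    ring
  | more n ih₀ ih₁ =>
    rw [cfA, cfB]
    have hD : ∀ x y A₁ A₀ B₁ B₀ : ℝ, x * A₁ + y * A₀ - 2 * (x * B₁ + y * B₀) =
        x * (A₁ - 2 * B₁) + y * (A₀ - 2 * B₀) := by intros; ring
    rw [hD, ih₀, ih₁, han (n + 1 + 1) (by lia), hdn (n + 1 + 1) (by lia),
      Nat.factorial_succ (n + 1), Nat.factorial_succ n]
    push_cast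
    ring

theorem tendsto_add_two_div_two_pow :
    Tendsto (fun n : ℕ => ((n : ℝ) + 2) / 2 ^ n) atTop (𝓝 0) := by
  have h₁ := tendsto_self_mul_const_pow_of_lt_one (r := (1 / 2 : ℝ)) (by norm_num) (by norm_num)
  have h₂ := (tendsto_pow_atTop_nhds_zero_of_lt_one (r := (1 / 2 : ℝ))
    (by norm_num) (by norm_num)).const_mul 2
  have h := h₁.add h₂
  rw [mul_zero, add_zero] at h
  refine h.congr fun n => ?_
  rw [one_div, inv_pow]
  ring


theorem example_EX2 (b : Polynomial ℝ) (a d : ℕ → ℝ)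
    (hb : ∀ n : ℕ, 1 ≤ n → 2 ≤ b.eval (n : ℝ))
    (ha1 : a 1 = 3 + 2 * b.eval 1)
    (hd1 : d 1 = b.eval 1)
    (han : ∀ n : ℕ, 2 ≤ n → a n =
      ((n : ℝ) - 1) * ((n : ℝ) + 2 + ((n : ℝ) + 1) * b.eval (n : ℝ)))
    (hdn : ∀ n : ℕ, 2 ≤ n → d n = (n : ℝ) * b.eval (n : ℝ)) :
    Tendsto (fun n : ℕ => cfA 0 a d (n + 1) / cfB 0 a d (n + 1)) atTop
      (nhds 2) := by
  have hdn' : ∀ n : ℕ, 1 ≤ n → d n = (n : ℝ) * b.eval (n : ℝ) := by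
    intro n hn
    rcases hn.eq_or_lt with rfl | h
    · simp [hd1]
    · exact hdn n h
  have ha : ∀ n, 1 ≤ n → 0 ≤ a n := by
    intro n hn
    have hbn := hb n hn
    rcases hn.eq_or_lt with rfl | h
    · rw [Nat.cast_one] at hbn
      rw [ha1]
      linarith
    · have hn' : (0 : ℝ) ≤ (n : ℝ) - 1 := by
        rw [sub_nonneg]
        exact_mod_cast hn
      rw [han n h]
      positivity
  have hd : ∀ n : ℕ, 1 ≤ n → 2 * (n : ℝ) ≤ d n := by
    intro n hn
    rw [hdn' n hn, mul_comm]
    exact mul_le_mul_of_nonneg_left (hb n hn) n.cast_nonneg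
  rw [tendsto_iff_norm_sub_tendsto_zero]
  refine squeeze_zero (fun _ => norm_nonneg _) (fun n => ?_) tendsto_add_two_div_two_pow
  have hB := (cfB_ge_two_pow_mul_factorial (b₀ := 0) ha hd n).1
  have hfac : (0 : ℝ) < n.factorial := by exact_mod_cast n.factorial_pos
  have hBpos : 0 < cfB 0 a d (n + 1) := lt_of_lt_of_le (by positivity) hB
  have hD := cfA_sub_two_mul_cfB (β := fun n => b.eval (n : ℝ)) (by simpa using ha1) han hdn' n
  rw [div_sub' hBpos.ne', mul_comm (cfB 0 a d (n + 1)) 2, hD, norm_div, norm_mul, norm_pow,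
    norm_neg, norm_one, one_pow, one_mul, Real.norm_of_nonneg (by positivity),
    Real.norm_of_nonneg hBpos.le, div_le_div_iff₀ hBpos (by positivity)]
  calc ((n : ℝ) + 2) * n.factorial * 2 ^ n = ((n : ℝ) + 2) * (2 ^ n * n.factorial) := by ring
    _ ≤ ((n : ℝ) + 2) * cfB 0 a d (n + 1) := by gcongr
end

section
/- Let c be a (real) polynomial with c(n) ≥ 2 for all integers n ≥ 0, and write c_n = c(n). Then the continued fraction with partial numerators and denominators a_1 = c_1 + 2, d_1 = 2c_1, and for n ≥ 2, a_n = (1 + (n-3)^2)·((1 + (n-1)^2)·c_n + (1 + n^2)), d_n = (1 + (n-2)^2)·c_n, converges and its limit is 1/2. -/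
open Filter Topology Polynomial

/-- If `r` satisfies the tail recurrence `aₙ₊₁ = rₙ (dₙ₊₁ + rₙ₊₁)`, then `Aₙ - (b₀ + r₀) Bₙ` is,
up to sign, a product of the `rᵢ`. -/
theorem cfA_sub_mul_cfB {b₀ : ℝ} {a d r : ℕ → ℝ}
    (h : ∀ n, a (n + 1) = r n * (d (n + 1) + r (n + 1))) (n : ℕ) :
    cfA b₀ a d n - (b₀ + r 0) * cfB b₀ a d n = (-1) ^ n * ∏ i ∈ Finset.range n, r i := by
  induction n using Nat.twoStepInduction with
  | zero => simp [cfA, cfB]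
  | one => simp [cfA, cfB]
  | more n ih₀ ih₁ =>
    rw [Finset.prod_range_succ, pow_succ] at ih₁
    rw [cfA, cfB, h, Finset.prod_range_succ, Finset.prod_range_succ, pow_add]
    linear_combination d (n + 1) * ih₁ + r n * (d (n + 1) + r (n + 1)) * ih₀

/-- Geometric growth of the canonical denominators relative to the products of a tail sequence. -/
theorem mul_prod_le_cfB {b₀ τ : ℝ} {a d r : ℕ → ℝ} (hτ : 0 < τ) (hr : ∀ n, 0 < r n)
    (h : ∀ n, a (n + 1) = r n * (d (n + 1) + r (n + 1)))
    (hd : ∀ n, τ * r (n + 1) ≤ d (n + 1)) (n : ℕ) :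
    τ * (1 + τ) ^ n * ∏ i ∈ Finset.range (n + 1), r i ≤
      (1 + τ) * r 0 * cfB b₀ a d (n + 1) := by
  induction n using Nat.twoStepInduction with
  | zero =>
    simp only [pow_zero, zero_add, Finset.prod_range_one, cfB]
    nlinarith [hr 0]
  | one =>
    simp only [Finset.prod_range_succ, Finset.prod_range_zero, cfB, pow_one]
    have := mul_le_mul_of_nonneg_left (hd 0) (mul_nonneg (by linarith : 0 ≤ 1 + τ) (hr 0).le)
    simp only [zero_add] at this ⊢
    linarith
  | more n ih₀ ih₁ =>
    rw [Finset.prod_range_succ] at ih₁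
    rw [cfB, h, Finset.prod_range_succ, Finset.prod_range_succ]
    set P := ∏ i ∈ Finset.range (n + 1), r i
    have hP0 : 0 < P := Finset.prod_pos fun i _ => hr i
    have hs : 0 < r (n + 1) := hr _
    have ht : 0 < r (n + 2) := hr _
    have hdn : τ * r (n + 2) ≤ d (n + 2) := hd (n + 1)
    have hd0 : 0 ≤ d (n + 2) := (mul_pos hτ ht).le.trans hdn
    have e₁ := mul_le_mul_of_nonneg_left ih₁ hd0
    have e₀ := mul_le_mul_of_nonneg_left ih₀
      (mul_nonneg hs.le (add_nonneg hd0 ht.le))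
    have e := mul_le_mul_of_nonneg_left hdn
      (by positivity : 0 ≤ τ * (1 + τ) ^ n * P * r (n + 1) * (2 + τ))
    rw [pow_succ] at e₁
    rw [pow_add]
    linarith

/-- A continued fraction with a positive tail sequence `r` such that `dₙ / rₙ` is bounded below by
a positive constant converges to `b₀ + r₀`. -/
theorem tendsto_cfA_div_cfB {b₀ τ : ℝ} {a d r : ℕ → ℝ} (hτ : 0 < τ) (hr : ∀ n, 0 < r n)
    (h : ∀ n, a (n + 1) = r n * (d (n + 1) + r (n + 1)))
    (hd : ∀ n, τ * r (n + 1) ≤ d (n + 1)) :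
    Tendsto (fun n : ℕ => cfA b₀ a d (n + 1) / cfB b₀ a d (n + 1)) atTop (𝓝 (b₀ + r 0)) := by
  have hτ' : 0 < 1 + τ := by linarith
  have hr0 := hr 0
  have hgeo : Tendsto (fun n : ℕ => (1 + τ) * r 0 / τ * (1 / (1 + τ)) ^ n) atTop (𝓝 0) := by
    simpa using (tendsto_pow_atTop_nhds_zero_of_lt_one (r := 1 / (1 + τ)) (by positivity)
      ((div_lt_one hτ').2 (by linarith))).const_mul ((1 + τ) * r 0 / τ)
  refine tendsto_iff_norm_sub_tendsto_zero.2
    (squeeze_zero (fun _ => norm_nonneg _) (fun n => ?_) hgeo)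
  have hP : 0 < ∏ i ∈ Finset.range (n + 1), r i := Finset.prod_pos fun i _ => hr i
  have hle := mul_prod_le_cfB (b₀ := b₀) hτ hr h hd n
  have hB : 0 < cfB b₀ a d (n + 1) :=
    pos_of_mul_pos_right ((mul_pos (by positivity) hP).trans_le hle) (by positivity)
  have hX := cfA_sub_mul_cfB (b₀ := b₀) h (n + 1)
  rw [div_sub' hB.ne', mul_comm (cfB _ _ _ _), hX, norm_div, norm_mul, norm_pow, norm_neg,
    norm_one, one_pow, one_mul, Real.norm_of_nonneg hP.le, Real.norm_of_nonneg hB.le,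
    div_le_iff₀ hB, one_div, inv_pow, div_mul_eq_mul_div, ← div_eq_mul_inv, div_div,
    div_mul_eq_mul_div, le_div_iff₀ (by positivity)]
  linarith

theorem example_Ex1 (c : Polynomial ℝ) (a d : ℕ → ℝ)
    (hc : ∀ n : ℕ, 2 ≤ c.eval (n : ℝ))
    (ha1 : a 1 = c.eval 1 + 2)
    (hd1 : d 1 = 2 * c.eval 1)
    (han : ∀ n : ℕ, 2 ≤ n → a n =
      (1 + ((n : ℝ) - 3) ^ 2) *
        ((1 + ((n : ℝ) - 1) ^ 2) * c.eval (n : ℝ) + (1 + (n : ℝ) ^ 2)))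
    (hdn : ∀ n : ℕ, 2 ≤ n → d n = (1 + ((n : ℝ) - 2) ^ 2) * c.eval (n : ℝ)) :
    Tendsto (fun n : ℕ => cfA 0 a d (n + 1) / cfB 0 a d (n + 1)) atTop
      (nhds (1 / 2)) := by
  let r : ℕ → ℝ := fun n => if n = 0 then 1 / 2 else
    (1 + ((n : ℝ) - 2) ^ 2) * (1 + (n : ℝ) ^ 2) / (1 + ((n : ℝ) - 1) ^ 2)
  have hrs (n : ℕ) : r (n + 1) =
      (1 + ((n : ℝ) - 1) ^ 2) * (1 + ((n : ℝ) + 1) ^ 2) / (1 + (n : ℝ) ^ 2) := by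
    simp only [r, Nat.add_eq_zero_iff, one_ne_zero, and_false, if_false]
    push_cast
    ring_nf
  have hr0 : r 0 = 1 / 2 := if_pos rfl
  have hr (n : ℕ) : 0 < r n := by
    cases n with
    | zero => rw [hr0]; norm_num
    | succ n => rw [hrs]; positivity
  have hd (n : ℕ) : d (n + 1) = (1 + ((n : ℝ) - 1) ^ 2) * c.eval ((n : ℝ) + 1) := by
    cases n with
    | zero => norm_num [hd1]
    | succ n =>
      rw [hdn _ (by omega)]
      push_cast
      ring_nf
  have ha (n : ℕ) : a (n + 1) = r n * (d (n + 1) + r (n + 1)) := by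
    rw [hd, hrs]
    cases n with
    | zero =>
      norm_num [ha1, hr0]
      ring
    | succ n =>
      rw [han _ (by omega), hrs]
      push_cast
      rw [show (n : ℝ) + 1 + 1 - 3 = n - 1 by ring, show (n : ℝ) + 1 + 1 - 1 = n + 1 by ring,
        show (n : ℝ) + 1 - 1 = n by ring]
      have h₀ : (1 + (n : ℝ) ^ 2) ≠ 0 := by positivity
      have h₁ : (1 + ((n : ℝ) + 1) ^ 2) ≠ 0 := by positivity
      field_simp
  have hτ (n : ℕ) : 2 / 3 * r (n + 1) ≤ d (n + 1) := by
    have hcn := hc (n + 1)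
    push_cast at hcn
    rw [hd, hrs, mul_div_assoc, mul_left_comm]
    refine mul_le_mul_of_nonneg_left (le_trans ?_ hcn) (by positivity)
    rw [← mul_div_assoc, div_le_iff₀ (by positivity)]
    nlinarith [sq_nonneg (2 * (n : ℝ) - 1)]
  simpa [hr0] using tendsto_cfA_div_cfB (b₀ := 0) (by norm_num) hr ha hτ
end

section
/- Let c be a (real) polynomial with c(n) ≥ 2 for all integers n ≥ -1, and write c_n = c(n). Then the continued fraction with partial numerators and denominators a_1 = c_0 + c_1^2, d_1 = c_1^2, and for n ≥ 2, a_n = c_{n-2}·(c_{n-1} + c_n^2), d_n = c_n^2, converges and its limit is 1. -/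
open Filter Topology Polynomial

/-- If `u` is a positive sequence with `u n ≤ u (n + 1) ^ 2` eventually and
`u (n + 1) * β (n + 2) = u (n + 2) ^ 2 * (β (n + 1) + β n) + u (n + 1) * β n`
with positive initial values, then `β` tends to infinity. -/
theorem tendsto_atTop_of_rec {u β : ℕ → ℝ} (hu : ∀ n, 0 < u n)
    (hev : ∀ᶠ n in atTop, u n ≤ u (n + 1) ^ 2) (h0 : 0 < β 0) (h1 : 0 < β 1)
    (hβ : ∀ n, u (n + 1) * β (n + 2) =
      u (n + 2) ^ 2 * (β (n + 1) + β n) + u (n + 1) * β n) :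
    Tendsto β atTop atTop := by
  have hpos : ∀ n, 0 < β n ∧ 0 < β (n + 1) := by
    intro n
    induction n with
    | zero => exact ⟨h0, h1⟩
    | succ k ih =>
      obtain ⟨hk, hk'⟩ := ih
      refine ⟨hk', pos_of_mul_pos_right ?_ (hu (k + 1)).le⟩
      rw [hβ]
      have := hu (k + 1)
      positivity
  obtain ⟨N, hN⟩ := eventually_atTop.1 hev
  have hstep : ∀ n, N ≤ n → β (n + 1) + 2 * β n ≤ β (n + 2) := by
    intro n hn
    refine le_of_mul_le_mul_left ?_ (hu (n + 1))
    rw [hβ]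
    have hS : 0 < β (n + 1) + β n := add_pos (hpos n).2 (hpos n).1
    nlinarith [mul_le_mul_of_nonneg_right (hN (n + 1) (by omega)) hS.le,
      mul_pos (hu (n + 1)) (hpos n).1]
  have hsum : Tendsto (fun k => β (k + N + 1) + β (k + N)) atTop atTop := by
    refine tendsto_atTop_of_geom_le (c := 2) ?_ one_lt_two fun k => ?_
    · exact add_pos (hpos _).2 (hpos _).1
    · have h := hstep (k + N) (by omega)
      rw [show k + 1 + N = k + N + 1 by omega]
      linarith
  rw [← tendsto_add_atTop_iff_nat (N + 2)]
  refine tendsto_atTop_mono (fun k => ?_) hsum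
  rw [← add_assoc]
  linarith [hstep (k + N) (by omega), (hpos (k + N)).1]

/-- A polynomial that is at least `1` on the natural numbers satisfies `c(n) ≤ c(n + 1) ^ 2`
eventually. -/
theorem Polynomial.eventually_eval_le_eval_succ_sq {c : ℝ[X]} (hc : ∀ n : ℕ, 1 ≤ c.eval (n : ℝ)) :
    ∀ᶠ n : ℕ in atTop, c.eval (n : ℝ) ≤ c.eval ((n + 1 : ℕ) : ℝ) ^ 2 := by
  rcases Nat.eq_zero_or_pos c.natDegree with h | h
  · obtain ⟨x, rfl⟩ := natDegree_eq_zero.1 h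
    refine Eventually.of_forall fun n => ?_
    have := hc n
    simp only [eval_C] at this ⊢
    nlinarith
  · have hdeg : c.degree < ((c.comp (X + 1)) ^ 2).degree := by
      apply degree_lt_degree
      have hX : (X + 1 : ℝ[X]).natDegree = 1 := natDegree_X_add_C 1
      rw [natDegree_pow, natDegree_comp, hX]
      omega
    have hlim := (div_tendsto_atTop_zero_of_degree_lt c _ hdeg).comp
      (tendsto_natCast_atTop_atTop (R := ℝ))
    filter_upwards [hlim.eventually_le_const one_pos] with n hn
    have hn1 := hc (n + 1)
    push_cast at hn1 ⊢
    simp only [Function.comp_apply, eval_pow, eval_comp, eval_add, eval_X, eval_one] at hn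
    rwa [div_le_one (by positivity)] at hn

theorem example_expinch3 (c : Polynomial ℝ) (a d : ℕ → ℝ)
    (hc : ∀ m : ℤ, -1 ≤ m → 2 ≤ c.eval (m : ℝ))
    (ha1 : a 1 = c.eval 0 + (c.eval 1) ^ 2)
    (hd1 : d 1 = (c.eval 1) ^ 2)
    (han : ∀ n : ℕ, 2 ≤ n → a n =
      c.eval ((n : ℝ) - 2) * (c.eval ((n : ℝ) - 1) + (c.eval (n : ℝ)) ^ 2))
    (hdn : ∀ n : ℕ, 2 ≤ n → d n = (c.eval (n : ℝ)) ^ 2) :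
    Tendsto (fun n : ℕ => cfA 0 a d (n + 1) / cfB 0 a d (n + 1)) atTop
      (nhds 1) := by
  set u : ℕ → ℝ := fun n => c.eval (n : ℝ) with hu_def
  have hu2 : ∀ n, 2 ≤ u n := fun n => by simpa using hc n (by omega)
  have hu : ∀ n, 0 < u n := fun n => two_pos.trans_le (hu2 n)
  have ha1' : a 1 = u 0 + u 1 ^ 2 := by simpa [hu_def] using ha1
  have hd1' : d 1 = u 1 ^ 2 := by simpa [hu_def] using hd1
  have ha : ∀ n, a (n + 2) = u n * (u (n + 1) + u (n + 2) ^ 2) := by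
    intro n
    rw [han (n + 2) (by omega)]
    simp only [hu_def]
    congr <;> push_cast <;> ring
  have hd : ∀ n, d (n + 2) = u (n + 2) ^ 2 := fun n => hdn (n + 2) (by omega)
  set P : ℕ → ℝ := fun n => ∏ i ∈ Finset.range n, u i with hP_def
  have hP : ∀ n, 0 < P n := fun n => Finset.prod_pos fun i _ => hu i
  have hPs : ∀ n, P (n + 1) = P n * u n := fun n => Finset.prod_range_succ _ _
  have hP0 : P 0 = 1 := Finset.prod_range_zero _
  have hdiff : ∀ n, cfA 0 a d (n + 1) - cfB 0 a d (n + 1) = (-1) ^ (n + 1) * P n ∧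
      cfA 0 a d (n + 2) - cfB 0 a d (n + 2) = (-1) ^ (n + 2) * P (n + 1) := by
    intro n
    induction n with
    | zero => simp [cfA, cfB, hPs, hP0, ha1', hd1']
    | succ k ih =>
      refine ⟨ih.2, ?_⟩
      have hrec : cfA 0 a d (k + 3) - cfB 0 a d (k + 3) =
          d (k + 2) * (cfA 0 a d (k + 2) - cfB 0 a d (k + 2)) +
            a (k + 2) * (cfA 0 a d (k + 1) - cfB 0 a d (k + 1)) := by
        simp only [cfA, cfB]
        ring
      rw [hrec, ih.1, ih.2, ha, hd, hPs (k + 1), hPs k]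
      ring
  have hβ : Tendsto (fun n => cfB 0 a d (n + 1) / P n) atTop atTop := by
    refine tendsto_atTop_of_rec hu
      (Polynomial.eventually_eval_le_eval_succ_sq fun n => one_le_two.trans (hu2 n)) ?_ ?_ ?_
    · simp [cfB, hP0]
    · have := hu 0
      have := hu 1
      have h : cfB 0 a d (1 + 1) / P 1 = u 1 ^ 2 / u 0 := by simp [cfB, hPs 0, hP0, hd1']
      rw [h]
      positivity
    · intro n
      have hrec : cfB 0 a d (n + 3) = d (n + 2) * cfB 0 a d (n + 2) +
          a (n + 2) * cfB 0 a d (n + 1) := rfl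
      have h1 := (hP n).ne'
      have h2 := (hu n).ne'
      have h3 := (hu (n + 1)).ne'
      rw [hrec, ha, hd, hPs (n + 1), hPs n]
      field_simp
      ring
  have hzero : Tendsto (fun n => (-1 : ℝ) ^ (n + 1) * (cfB 0 a d (n + 1) / P n)⁻¹) atTop (𝓝 0) :=
    by
    rw [tendsto_zero_iff_norm_tendsto_zero]
    simpa [abs_div] using (tendsto_inv_atTop_zero.comp hβ).abs
  have hone := hzero.const_add 1
  rw [add_zero] at hone
  refine hone.congr' ?_
  filter_upwards [hβ.eventually_gt_atTop 0] with n hn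
  have hB : cfB 0 a d (n + 1) ≠ 0 := fun h => by simp [h] at hn
  rw [inv_div, ← mul_div_assoc, ← (hdiff n).1]
  field_simp
  ring
end

section
/- (Generalized Euler transformation) Let (a_k)_{k≥0} be a sequence of real numbers such that the series ∑_{k=0}^∞ a_k converges to S, and let (b_n)_{n≥0} be a sequence of real numbers with b_n → 0 as n → ∞ and a_n + b_n − b_{n-1} ≠ 0 for all n ≥ 1. Then the continued fraction with constant term a_0 + b_0 and partial numerators and denominators c_1 = a_1 + b_1 − b_0, d_1 = 1; c_2 = −a_2 + b_1 − b_2, d_2 = a_2 + a_1 + b_2 − b_0; and for n ≥ 3, c_n = −(a_{n-2} + b_{n-2} − b_{n-3})(a_n + b_n − b_{n-1}), d_n = a_n + a_{n-1} + b_n − b_{n-2}, converges and its limit is S. -/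
open Filter Topology Polynomial

/-- Canonical numerators and denominators in closed form when the elements of the continued fraction
are built from the increments `t (n + 1) - t n` of a sequence `t`. -/
lemma cfA_cfB_of_increments (t c d : ℕ → ℝ)
    (hc1 : c 1 = t 1 - t 0) (hd1 : d 1 = 1)
    (hc2 : c 2 = -(t 2 - t 1)) (hd2 : d 2 = t 2 - t 0)
    (hc : ∀ n, c (n + 3) = -((t (n + 1) - t n) * (t (n + 3) - t (n + 2))))
    (hd : ∀ n, d (n + 3) = t (n + 3) - t (n + 1)) (n : ℕ) :
    cfB (t 0) c d (n + 2) = ∏ i ∈ Finset.range n, (t (i + 1) - t i) ∧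
      cfA (t 0) c d (n + 2) = t (n + 1) * ∏ i ∈ Finset.range n, (t (i + 1) - t i) := by
  induction n using Nat.twoStepInduction with
  | zero => simp [cfA, cfB, hc1, hd1]
  | one =>
    simp only [cfA, cfB, hc1, hd1, hc2, hd2, Finset.prod_range_one, zero_add, Nat.reduceAdd]
    constructor <;> ring
  | more n ih₀ ih₁ =>
    constructor
    · rw [cfB, ih₀.1, ih₁.1, hc, hd, Finset.prod_range_succ _ (n + 1), Finset.prod_range_succ _ n]
      ring
    · rw [cfA, ih₀.2, ih₁.2, hc, hd, Finset.prod_range_succ _ (n + 1), Finset.prod_range_succ _ n]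
      ring

theorem generalized_euler (a b c d : ℕ → ℝ) (S : ℝ)
    (hsum : Tendsto (fun n : ℕ => ∑ k ∈ Finset.range n, a k) atTop (nhds S))
    (hb : Tendsto b atTop (nhds 0))
    (hnz : ∀ n : ℕ, 1 ≤ n → a n + b n - b (n - 1) ≠ 0)
    (hc1 : c 1 = a 1 + b 1 - b 0)
    (hd1 : d 1 = 1)
    (hc2 : c 2 = -a 2 + b 1 - b 2)
    (hd2 : d 2 = a 2 + a 1 + b 2 - b 0)
    (hcn : ∀ n : ℕ, 3 ≤ n → c n =
      -((a (n - 2) + b (n - 2) - b (n - 3)) * (a n + b n - b (n - 1))))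
    (hdn : ∀ n : ℕ, 3 ≤ n → d n = a n + a (n - 1) + b n - b (n - 2)) :
    Tendsto (fun n : ℕ =>
        cfA (a 0 + b 0) c d (n + 1) / cfB (a 0 + b 0) c d (n + 1)) atTop
      (nhds S) := by
  set t : ℕ → ℝ := fun n => ∑ k ∈ Finset.range (n + 1), a k + b n with ht
  have ht0 : a 0 + b 0 = t 0 := by simp [ht]
  have hstep (n : ℕ) : t (n + 1) - t n = a (n + 1) + b (n + 1) - b n := by
    simp only [ht, Finset.sum_range_succ _ (n + 1)]
    ring
  have hlim : Tendsto t atTop (𝓝 S) := by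
    simpa using (hsum.comp (tendsto_add_atTop_nat 1)).add hb
  have key := cfA_cfB_of_increments t c d
    (by rw [hc1, hstep]) hd1 (by rw [hc2, hstep]; ring)
    (by rw [hd2]; linarith [hstep 0, hstep 1])
    (fun n => by simpa [hstep] using hcn (n + 3) (by omega))
    (fun n => by
      have h : d (n + 3) = a (n + 3) + a (n + 2) + b (n + 3) - b (n + 1) := hdn (n + 3) (by omega)
      linarith [hstep (n + 1), hstep (n + 2)])
  rw [ht0, ← tendsto_add_atTop_iff_nat 1]
  refine (hlim.comp (tendsto_add_atTop_nat 1)).congr fun n => ?_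
  have hP : ∏ i ∈ Finset.range n, (t (i + 1) - t i) ≠ 0 :=
    Finset.prod_ne_zero_iff.2 fun i _ => by
      rw [hstep]
      exact hnz (i + 1) (by omega)
  rw [(key n).1, (key n).2, mul_div_cancel_right₀ _ hP, Function.comp_apply]
end

section
/- Let k ≥ 2 be an integer. Then the continued fraction with constant term 0 and partial numerators and denominators a_1 = 1, b_1 = 1, and for n ≥ 2, a_n = −(n−1)^{2k}, b_n = n^k + (n−1)^k, converges and its limit is ζ(k) = ∑_{n=1}^∞ 1/n^k. -/
open Filter Topology Polynomial

theorem cfB_zeta (k : ℕ) (a b : ℕ → ℝ)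
    (hb1 : b 1 = 1)
    (han : ∀ n : ℕ, 2 ≤ n → a n = -(((n : ℝ) - 1) ^ (2 * k)))
    (hbn : ∀ n : ℕ, 2 ≤ n → b n = (n : ℝ) ^ k + ((n : ℝ) - 1) ^ k) (n : ℕ) :
    cfB 0 a b (n + 1) = (n.factorial : ℝ) ^ k := by
  induction n using Nat.twoStepInduction with
  | zero => simp [cfB]
  | one => simp [cfB, hb1]
  | more n ih₀ ih₁ =>
    rw [cfB, ih₀, ih₁, han _ (by lia), hbn _ (by lia)]
    simp only [Nat.factorial_succ]
    push_cast
    rw [show ((n : ℝ) + 1 + 1 - 1) = n + 1 by ring, pow_mul']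
    simp only [mul_pow]
    ring

theorem cfA_zeta (k : ℕ) (a b : ℕ → ℝ)
    (ha1 : a 1 = 1)
    (han : ∀ n : ℕ, 2 ≤ n → a n = -(((n : ℝ) - 1) ^ (2 * k)))
    (hbn : ∀ n : ℕ, 2 ≤ n → b n = (n : ℝ) ^ k + ((n : ℝ) - 1) ^ k) (n : ℕ) :
    cfA 0 a b (n + 1) =
      (n.factorial : ℝ) ^ k * ∑ i ∈ Finset.range n, 1 / ((i : ℝ) + 1) ^ k := by
  induction n using Nat.twoStepInduction with
  | zero => simp [cfA]
  | one => simp [cfA, ha1]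
  | more n ih₀ ih₁ =>
    rw [cfA, ih₀, ih₁, han _ (by lia), hbn _ (by lia)]
    simp only [Nat.factorial_succ, Finset.sum_range_succ]
    push_cast
    rw [show ((n : ℝ) + 1 + 1 - 1) = n + 1 by ring, pow_mul']
    simp only [mul_pow]
    have h₁ : ((n : ℝ) + 1) ^ k ≠ 0 := by positivity
    have h₂ : ((n : ℝ) + 1 + 1) ^ k ≠ 0 := by positivity
    generalize ((n : ℝ) + 1) ^ k = x at *
    generalize ((n : ℝ) + 1 + 1) ^ k = y at *
    field_simp
    ring

theorem zeta_cf (k : ℕ) (hk : 2 ≤ k) (a b : ℕ → ℝ)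
    (ha1 : a 1 = 1)
    (hb1 : b 1 = 1)
    (han : ∀ n : ℕ, 2 ≤ n → a n = -(((n : ℝ) - 1) ^ (2 * k)))
    (hbn : ∀ n : ℕ, 2 ≤ n → b n = (n : ℝ) ^ k + ((n : ℝ) - 1) ^ k) :
    Tendsto (fun n : ℕ => cfA 0 a b (n + 1) / cfB 0 a b (n + 1)) atTop
      (nhds (∑' n : ℕ, 1 / ((n : ℝ) + 1) ^ k)) := by
  have hsum : Summable fun n : ℕ => 1 / ((n : ℝ) + 1) ^ k := by
    simpa using (summable_nat_add_iff 1).2 (Real.summable_one_div_nat_pow.2 hk)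
  refine hsum.hasSum.tendsto_sum_nat.congr fun n => ?_
  rw [cfA_zeta k a b ha1 han hbn, cfB_zeta k a b hb1 han hbn, mul_div_cancel_left₀]
  positivity
end

section
/- Let k ≥ 2 be an integer and let A be a positive integer such that A(n+1) ≠ n^{k-1} for every integer n ≥ 1. Then the continued fraction with constant term 1/A and partial numerators and denominators a_1 = 2A − 1, b_1 = 2A; a_2 = −2A(3A − 2^{k-1}), b_2 = 3A(1 + 2^k) − 2^{k+1}; and for n ≥ 3, a_n = −n(n−1)^{2k−1}·(A(n−1) − (n−2)^{k−1})·(A(n+1) − n^{k−1}), b_n = A(n+1)((n−1)^k + n^k) − 2n^k(n−1)^{k−1}, converges and its limit is ζ(k) = ∑_{n=1}^∞ 1/n^k. -/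
open Filter Topology Polynomial

/-- The approximants of the continued fraction: a partial sum of `ζ(j + 1)` plus `1 / (A (n + 1))`. -/
noncomputable def zetaApprox (j : ℕ) (A : ℝ) (n : ℕ) : ℝ :=
  ∑ i ∈ Finset.range n, 1 / ((i : ℝ) + 1) ^ (j + 1) + 1 / (A * ((n : ℝ) + 1))

theorem zetaApprox_succ (j : ℕ) {A : ℝ} (hA : A ≠ 0) (n : ℕ) :
    zetaApprox j A (n + 1) = zetaApprox j A n +
      (A * ((n : ℝ) + 2) - ((n : ℝ) + 1) ^ j) /
        (A * ((n : ℝ) + 1) ^ (j + 1) * ((n : ℝ) + 2)) := by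
  have h1 : (n : ℝ) + 1 ≠ 0 := by positivity
  have h2 : (n : ℝ) + 2 ≠ 0 := by positivity
  have h3 : (n : ℝ) + 1 + 1 ≠ 0 := by positivity
  simp only [zetaApprox, Finset.sum_range_succ]
  push_cast
  field_simp
  ring

theorem tendsto_zetaApprox {j : ℕ} (hj : 1 ≤ j) (A : ℝ) :
    Tendsto (zetaApprox j A) atTop (𝓝 (∑' n : ℕ, 1 / ((n : ℝ) + 1) ^ (j + 1))) := by
  have hs : Summable fun n : ℕ => 1 / ((n : ℝ) + 1) ^ (j + 1) := by
    simpa using (summable_nat_add_iff 1).2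
      (Real.summable_one_div_nat_pow.2 (Nat.lt_succ_of_le hj))
  have h0 : Tendsto (fun n : ℕ => 1 / (A * ((n : ℝ) + 1))) atTop (𝓝 0) := by
    simpa [mul_comm] using (tendsto_one_div_add_atTop_nhds_zero_nat (𝕜 := ℝ)).const_mul A⁻¹
  rw [← add_zero (∑' n : ℕ, _)]
  exact hs.hasSum.tendsto_sum_nat.add h0

theorem cfB_succ_and_cfA_eq {j : ℕ} (hj : j ≠ 0) {A : ℝ} (hA : A ≠ 0) {a b : ℕ → ℝ}
    (ha1 : a 1 = 2 * A - 1) (hb1 : b 1 = 2 * A)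
    (ha : ∀ m : ℕ, a (m + 2) = -(((m : ℝ) + 2) * ((m : ℝ) + 1) ^ (2 * j + 1) *
      (A * ((m : ℝ) + 1) - (m : ℝ) ^ j) * (A * ((m : ℝ) + 3) - ((m : ℝ) + 2) ^ j)))
    (hb : ∀ m : ℕ, b (m + 2) =
      A * ((m : ℝ) + 3) * (((m : ℝ) + 1) ^ (j + 1) + ((m : ℝ) + 2) ^ (j + 1)) -
        2 * ((m : ℝ) + 2) ^ (j + 1) * ((m : ℝ) + 1) ^ j) (m : ℕ) :
    cfB (1 / A) a b (m + 2) =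
        ((m : ℝ) + 2) * ((m : ℝ) + 1) ^ j * (A * ((m : ℝ) + 1) - (m : ℝ) ^ j) *
          cfB (1 / A) a b (m + 1) ∧
      cfA (1 / A) a b (m + 1) = zetaApprox j A m * cfB (1 / A) a b (m + 1) ∧
      cfA (1 / A) a b (m + 2) = zetaApprox j A (m + 1) * cfB (1 / A) a b (m + 2) := by
  induction m with
  | zero =>
    refine ⟨?_, ?_, ?_⟩
    · simp [cfB, hb1, hj]
    · simp [cfA, cfB, zetaApprox]
    · simp [cfA, cfB, zetaApprox, ha1, hb1]
      field_simp
      ring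
  | succ m ih =>
    obtain ⟨hB, hA0, hA1⟩ := ih
    have hB' : cfB (1 / A) a b (m + 3) =
        ((m : ℝ) + 3) * ((m : ℝ) + 2) ^ j * (A * ((m : ℝ) + 2) - ((m : ℝ) + 1) ^ j) *
          cfB (1 / A) a b (m + 2) := by
      rw [cfB, ha, hb, hB]
      ring
    refine ⟨?_, hA1, ?_⟩
    · push_cast
      rw [show m + 1 + 2 = m + 3 from rfl, hB']
      ring
    · have hx0 := zetaApprox_succ j hA m
      have hx1 := zetaApprox_succ j hA (m + 1)
      have h1 : (m : ℝ) + 1 ≠ 0 := by positivity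
      have h2 : (m : ℝ) + 2 ≠ 0 := by positivity
      have h3 : (m : ℝ) + 3 ≠ 0 := by positivity
      have key : a (m + 2) * cfB (1 / A) a b (m + 1) *
          (zetaApprox j A m - zetaApprox j A (m + 1)) =
          cfB (1 / A) a b (m + 3) * (zetaApprox j A (m + 2) - zetaApprox j A (m + 1)) := by
        rw [hx1, hx0, hB', hB, ha]
        push_cast
        rw [show (m : ℝ) + 1 + 1 = m + 2 by ring, show (m : ℝ) + 1 + 2 = m + 3 by ring]
        field_simp
        ring
      have hrec : cfB (1 / A) a b (m + 3) = b (m + 2) * cfB (1 / A) a b (m + 2) +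
          a (m + 2) * cfB (1 / A) a b (m + 1) := rfl
      change b (m + 2) * cfA (1 / A) a b (m + 2) + a (m + 2) * cfA (1 / A) a b (m + 1) =
        zetaApprox j A (m + 2) * cfB (1 / A) a b (m + 3)
      rw [hA0, hA1]
      linear_combination key - zetaApprox j A (m + 1) * hrec

theorem zeta_cf_family (k : ℕ) (hk : 2 ≤ k) (A : ℤ) (hA : 0 < A)
    (hAn : ∀ n : ℤ, 1 ≤ n → (A : ℝ) * ((n : ℝ) + 1) ≠ (n : ℝ) ^ (k - 1))
    (a b : ℕ → ℝ)
    (ha1 : a 1 = 2 * (A : ℝ) - 1)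
    (hb1 : b 1 = 2 * (A : ℝ))
    (ha2 : a 2 = -(2 * (A : ℝ) * (3 * (A : ℝ) - 2 ^ (k - 1))))
    (hb2 : b 2 = 3 * (A : ℝ) * (1 + 2 ^ k) - 2 ^ (k + 1))
    (han : ∀ n : ℕ, 3 ≤ n → a n =
      -((n : ℝ) * ((n : ℝ) - 1) ^ (2 * k - 1) *
        ((A : ℝ) * ((n : ℝ) - 1) - ((n : ℝ) - 2) ^ (k - 1)) *
        ((A : ℝ) * ((n : ℝ) + 1) - (n : ℝ) ^ (k - 1))))
    (hbn : ∀ n : ℕ, 3 ≤ n → b n =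
      (A : ℝ) * ((n : ℝ) + 1) * (((n : ℝ) - 1) ^ k + (n : ℝ) ^ k) -
        2 * (n : ℝ) ^ k * ((n : ℝ) - 1) ^ (k - 1)) :
    Tendsto (fun n : ℕ =>
        cfA (1 / (A : ℝ)) a b (n + 1) / cfB (1 / (A : ℝ)) a b (n + 1)) atTop
      (nhds (∑' n : ℕ, 1 / ((n : ℝ) + 1) ^ k)) := by
  obtain ⟨j, rfl⟩ : ∃ j, k = j + 1 := ⟨k - 1, by omega⟩
  have hj : 1 ≤ j := by omega
  simp only [Nat.add_sub_cancel, show 2 * (j + 1) - 1 = 2 * j + 1 by omega] at *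
  have hA' : (A : ℝ) ≠ 0 := by exact_mod_cast hA.ne'
  have hj0 : j ≠ 0 := by omega
  have ha (m : ℕ) : a (m + 2) = -(((m : ℝ) + 2) * ((m : ℝ) + 1) ^ (2 * j + 1) *
      ((A : ℝ) * ((m : ℝ) + 1) - (m : ℝ) ^ j) *
      ((A : ℝ) * ((m : ℝ) + 3) - ((m : ℝ) + 2) ^ j)) := by
    rcases m with _ | m
    · rw [ha2]
      simp only [Nat.cast_zero, zero_pow hj0, zero_add, one_pow]
      ring
    · rw [han _ (by omega)]
      push_cast
      ring_nf
  have hb (m : ℕ) : b (m + 2) =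
      (A : ℝ) * ((m : ℝ) + 3) * (((m : ℝ) + 1) ^ (j + 1) + ((m : ℝ) + 2) ^ (j + 1)) -
        2 * ((m : ℝ) + 2) ^ (j + 1) * ((m : ℝ) + 1) ^ j := by
    rcases m with _ | m
    · simp [hb2]
      ring
    · rw [hbn _ (by omega)]
      push_cast
      ring_nf
  have hcf := cfB_succ_and_cfA_eq hj0 hA' ha1 hb1 ha hb
  have hB (n : ℕ) : cfB (1 / (A : ℝ)) a b (n + 1) ≠ 0 := by
    induction n with
    | zero => simp [cfB]
    | succ n ih =>
      rw [(hcf n).1]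
      refine mul_ne_zero (mul_ne_zero (by positivity) (sub_ne_zero.2 ?_)) ih
      rcases n with _ | n
      · simpa [hj0] using hA'
      · exact_mod_cast hAn ((n + 1 : ℕ) : ℤ) (by omega)
  refine (tendsto_zetaApprox hj (A : ℝ)).congr fun n => ?_
  rw [(hcf n).2.1, mul_div_cancel_right₀ _ (hB n)]
end

section
/- Let x and α be real numbers with |x| < 1, and let r : ℕ → ℝ be given by a rational function, i.e., there are real polynomials p, q with q(n) ≠ 0 and r_n = p(n)/q(n) for all integers n ≥ 0. Define g_n = (α − n + 1)·x·(1 + r_n) − n·r_{n-1} for n ≥ 1, and assume g_n ≠ 0 for all n ≥ 1. Then the continued fraction with constant term 1 + r_0 and partial numerators and denominators a_1 = g_1, b_1 = 1; a_2 = −α·x·g_2, b_2 = α·x·((α − 1)·x·(1 + r_2) + 2) − 2r_0; and for n ≥ 3, a_n = −(n−1)·x·(α − n + 2)·g_{n-2}·g_n, b_n = (α − n + 2)·x·((α − n + 1)·x·(1 + r_n) + n) − n(n−1)·r_{n-2}, converges and its limit is (1 + x)^α (real power). -/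
open Filter Topology Polynomial

/-- The recursion satisfied by the terms `(α choose n) xⁿ` of the binomial series. -/
theorem Real.succ_mul_choose_mul_pow (α x : ℝ) (n : ℕ) :
    ((n : ℝ) + 1) * (Ring.choose α (n + 1) * x ^ (n + 1)) =
      (α - n) * x * (Ring.choose α n * x ^ n) := by
  have h₁ := Ring.descPochhammer_eq_factorial_smul_choose α (n + 1)
  have h₀ := Ring.descPochhammer_eq_factorial_smul_choose α n
  rw [descPochhammer_succ_right, Polynomial.smeval_mul, h₀] at h₁
  simp only [Polynomial.smeval_sub, Polynomial.smeval_X, pow_one, Polynomial.smeval_natCast,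
    pow_zero, nsmul_eq_mul, mul_one, Nat.factorial_succ, Nat.cast_mul, Nat.cast_add,
    Nat.cast_one] at h₁
  have hn : (n.factorial : ℝ) ≠ 0 := mod_cast n.factorial_ne_zero
  have h : ((n : ℝ) + 1) * Ring.choose α (n + 1) = (α - n) * Ring.choose α n :=
    mul_left_cancel₀ hn (by linear_combination -h₁)
  linear_combination x ^ (n + 1) * h

/-- The binomial series, as a `HasSum` statement. -/
theorem Real.hasSum_choose_mul_pow (α : ℝ) {x : ℝ} (hx : |x| < 1) :
    HasSum (fun n : ℕ => Ring.choose α n * x ^ n) ((1 + x) ^ α) := by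
  have hmem : x ∈ Metric.eball (0 : ℝ) 1 := by
    rw [← ENNReal.ofReal_one, Metric.eball_ofReal]
    simpa using hx
  simpa [-FormalMultilinearSeries.apply_eq_prod_smul_coeff, binomialSeries_apply] using
    (Real.one_add_rpow_hasFPowerSeriesOnBall_zero (a := α)).hasSum_sub hmem

/-- Rational functions grow slower than the terms of the binomial series decay. -/
theorem Real.tendsto_eval_div_eval_mul_choose_mul_pow (α : ℝ) {x : ℝ} (hx : |x| < 1)
    (p q : ℝ[X]) (hq : q ≠ 0) :
    Tendsto (fun n : ℕ => p.eval (n : ℝ) / q.eval (n : ℝ) * (Ring.choose α n * x ^ n))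
      atTop (𝓝 0) := by
  obtain ⟨ρ, hxρ, hρ⟩ := exists_between hx
  have hρ₀ : 0 < ρ := (abs_nonneg x).trans_lt hxρ
  set k := p.natDegree + 1
  have hdeg : p.degree < (q * X ^ k).degree := by
    refine degree_lt_degree ?_
    rw [natDegree_mul hq (pow_ne_zero _ X_ne_zero), natDegree_X_pow]
    omega
  have h₁ : Tendsto (fun n : ℕ => p.eval (n : ℝ) / (q * X ^ k).eval (n : ℝ)) atTop (𝓝 0) :=
    (Polynomial.div_tendsto_atTop_zero_of_degree_lt p _ hdeg).comp tendsto_natCast_atTop_atTop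
  have h₂ : Tendsto (fun n : ℕ => Ring.choose α n * ρ ^ n) atTop (𝓝 0) :=
    (Real.hasSum_choose_mul_pow α (by rwa [abs_of_pos hρ₀])).summable.tendsto_atTop_zero
  have h₃ : Tendsto (fun n : ℕ => (n : ℝ) ^ k * (x / ρ) ^ n) atTop (𝓝 0) := by
    refine tendsto_pow_const_mul_const_pow_of_abs_lt_one k ?_
    rwa [abs_div, abs_of_pos hρ₀, div_lt_one hρ₀]
  have h := (h₁.mul h₂).mul h₃
  simp only [mul_zero] at h
  refine h.congr' ?_
  filter_upwards [eventually_ne_atTop 0] with n hn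
  have hn' : (n : ℝ) ≠ 0 := mod_cast hn
  rw [eval_mul, eval_pow, eval_X, div_pow, div_mul_eq_div_div]
  field_simp

theorem binomial_cf (x α : ℝ) (hx : |x| < 1) (r g a b : ℕ → ℝ)
    (hr : ∃ p q : Polynomial ℝ, (∀ n : ℕ, q.eval (n : ℝ) ≠ 0) ∧
      ∀ n : ℕ, r n = p.eval (n : ℝ) / q.eval (n : ℝ))
    (hgdef : ∀ n : ℕ, 1 ≤ n → g n =
      (α - (n : ℝ) + 1) * x * (1 + r n) - (n : ℝ) * r (n - 1))
    (hg : ∀ n : ℕ, 1 ≤ n → g n ≠ 0)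
    (ha1 : a 1 = g 1)
    (hb1 : b 1 = 1)
    (ha2 : a 2 = -(α * x * g 2))
    (hb2 : b 2 = α * x * ((α - 1) * x * (1 + r 2) + 2) - 2 * r 0)
    (han : ∀ n : ℕ, 3 ≤ n → a n =
      -(((n : ℝ) - 1) * x * (α - (n : ℝ) + 2) * g (n - 2) * g n))
    (hbn : ∀ n : ℕ, 3 ≤ n → b n =
      (α - (n : ℝ) + 2) * x * ((α - (n : ℝ) + 1) * x * (1 + r n) + (n : ℝ)) -
        (n : ℝ) * ((n : ℝ) - 1) * r (n - 2)) :
    Tendsto (fun n : ℕ =>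
        cfA (1 + r 0) a b (n + 1) / cfB (1 + r 0) a b (n + 1)) atTop
      (nhds ((1 + x) ^ α)) := by
  obtain ⟨p, q, hq, hpq⟩ := hr
  have hq₀ : q ≠ 0 := by
    rintro rfl
    exact hq 0 eval_zero
  set t : ℕ → ℝ := fun n => Ring.choose α n * x ^ n with ht
  have ht₀ : t 0 = 1 := by simp [ht]
  have ht_succ (n : ℕ) : ((n : ℝ) + 1) * t (n + 1) = (α - n) * x * t n :=
    Real.succ_mul_choose_mul_pow α x n
  set W : ℕ → ℝ := fun n => ∑ k ∈ Finset.range (n + 1), t k + r n * t n with hW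
  have hW_lim : Tendsto W atTop (𝓝 ((1 + x) ^ α)) := by
    have hsum := (Real.hasSum_choose_mul_pow α hx).tendsto_sum_nat.comp (tendsto_add_atTop_nat 1)
    have hrem := Real.tendsto_eval_div_eval_mul_choose_mul_pow α hx p q hq₀
    simpa [hW, ht, hpq, Function.comp_def] using hsum.add hrem
  have hg_succ (n : ℕ) :
      g (n + 1) = (α - n) * x * (1 + r (n + 1)) - ((n : ℝ) + 1) * r n := by
    rw [hgdef (n + 1) n.succ_pos, Nat.add_sub_cancel]
    push_cast
    ring
  have hW_succ (n : ℕ) : ((n : ℝ) + 1) * (W (n + 1) - W n) = t n * g (n + 1) := by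
    simp only [hW, Finset.sum_range_succ _ (n + 1), hg_succ]
    linear_combination (1 + r (n + 1)) * ht_succ n
  have ha_add (n : ℕ) :
      a (n + 3) = -(((n : ℝ) + 2) * x * (α - n - 1) * g (n + 1) * g (n + 3)) := by
    rw [han (n + 3) (by omega), show n + 3 - 2 = n + 1 by omega]
    push_cast
    ring
  have hb_add (n : ℕ) :
      b (n + 3) = (α - n - 1) * x * ((α - n - 2) * x * (1 + r (n + 3)) + (n + 3)) -
        ((n : ℝ) + 3) * (n + 2) * r (n + 1) := by
    rw [hbn (n + 3) (by omega), show n + 3 - 2 = n + 1 by omega]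
    push_cast
    ring
  set A := cfA (1 + r 0) a b
  set B := cfB (1 + r 0) a b
  have hA_rec (n : ℕ) : A (n + 2) = b (n + 1) * A (n + 1) + a (n + 1) * A n := rfl
  have hB_rec (n : ℕ) : B (n + 2) = b (n + 1) * B (n + 1) + a (n + 1) * B n := rfl
  have hB₁ : B 1 = 1 := rfl
  have hB₂ : B 2 = 1 := by
    rw [hB_rec 0, show B 0 = 0 from rfl, zero_add, hb1, hB₁]
    ring
  have hA₁ : A 1 = W 0 := by
    rw [show A 1 = 1 + r 0 from rfl]
    simp [hW, ht₀]
  have hA₂ : A 2 = W 1 := by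
    have h := hW_succ 0
    rw [hA_rec 0, show A 0 = 1 from rfl, zero_add, hb1, ha1, hA₁]
    rw [ht₀] at h
    push_cast at h
    linear_combination -h
  have hB_succ (n : ℕ) : B (n + 3) = ((n : ℝ) + 2) * g (n + 1) * B (n + 2) := by
    induction n with
    | zero =>
      have h₁ := hg_succ 0
      have h₂ := hg_succ 1
      norm_num at h₁ h₂
      rw [hB_rec 1]
      norm_num
      rw [hB₁, hB₂, hb2, ha2, h₁, h₂]
      ring
    | succ n ih =>
      have h₂ := hg_succ (n + 1)
      have h₃ := hg_succ (n + 2)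
      push_cast at h₂ h₃
      rw [hB_rec (n + 2), show n + 2 + 1 = n + 3 from rfl, ih, ha_add, hb_add,
        show n + 1 + 1 = n + 2 from rfl, h₃, h₂]
      push_cast
      ring
  have hB_ne (n : ℕ) : B (n + 2) ≠ 0 := by
    induction n with
    | zero => simp [hB₂]
    | succ n ih =>
      rw [show n + 1 + 2 = n + 3 from rfl, hB_succ]
      exact mul_ne_zero (mul_ne_zero (by positivity) (hg _ n.succ_pos)) ih
  have hAB (n : ℕ) : A (n + 1) = B (n + 1) * W n ∧ A (n + 2) = B (n + 2) * W (n + 1) := by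
    induction n with
    | zero => simp [hA₁, hA₂, hB₁, hB₂]
    | succ n ih =>
      refine ⟨ih.2, ?_⟩
      obtain ⟨ih₁, ih₂⟩ := ih
      suffices h : a (n + 2) * B (n + 1) * (W n - W (n + 1)) =
          B (n + 3) * (W (n + 2) - W (n + 1)) by
        rw [hA_rec (n + 1), show n + 1 + 1 = n + 2 from rfl, ih₁, ih₂]
        linear_combination h - W (n + 1) * hB_rec (n + 1)
      cases n with
      | zero =>
        have hw₁ := hW_succ 0
        have hw₂ := hW_succ 1
        have ht₁ := ht_succ 0
        have hB₃ := hB_succ 0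
        norm_num [ht₀, hB₂] at hw₁ hw₂ ht₁ hB₃ ⊢
        rw [hB₁, hB₃, ha2]
        linear_combination α * x * g 2 * hw₁ - g 1 * hw₂ - g 1 * g 2 * ht₁
      | succ n =>
        have hw₁ := hW_succ (n + 1)
        have hw₂ := hW_succ (n + 2)
        have ht₁ := ht_succ (n + 1)
        have hB₄ := hB_succ (n + 1)
        push_cast at hw₁ hw₂ ht₁ hB₄
        simp only [add_assoc, Nat.reduceAdd] at hw₁ hw₂ ht₁ hB₄ ⊢
        rw [hB₄, hB_succ, ha_add]
        linear_combination x * (α - n - 1) * g (n + 1) * g (n + 3) * B (n + 2) * hw₁ -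
          (n + 2) * g (n + 1) * g (n + 2) * B (n + 2) * hw₂ -
          g (n + 1) * g (n + 2) * g (n + 3) * B (n + 2) * ht₁
  refine hW_lim.congr' ?_
  filter_upwards with n
  have hne : B (n + 1) ≠ 0 := by
    cases n with
    | zero => simp [hB₁]
    | succ n => exact hB_ne n
  rw [(hAB n).1, mul_div_cancel_left₀ _ hne]
end

section
/- Let A be an integer with A ≠ −7. Then the continued fraction with constant term 0 and partial numerators and denominators a_1 = A + 7, b_1 = 7; a_2 = 7(11A − 7), b_2 = −4A + 56; and for n ≥ 3, a_n = 7(5n − 11)(n − 2)·((12n − 37)A − 7)·((12n − 13)A − 7), b_n = −2A(12n^2 − 31n + 16) + 14(n + 2), converges and its limit is (12/7)^{1/5}, the real fifth root of 12/7. -/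
open Filter Topology Polynomial

/-- The coefficients of the binomial series satisfy a first-order recurrence. -/
lemma succ_mul_choose_succ (r : ℝ) (n : ℕ) :
    ((n : ℝ) + 1) * Ring.choose r (n + 1) = (r - n) * Ring.choose r n := by
  have hn : (n.factorial : ℝ) ≠ 0 := Nat.cast_ne_zero.mpr n.factorial_ne_zero
  have hn' : (n : ℝ) + 1 ≠ 0 := by positivity
  simp only [Ring.choose_eq_smul, descPochhammer_succ_right, Polynomial.smeval_mul,
    Polynomial.smeval_sub, Polynomial.smeval_X, Polynomial.smeval_natCast, Nat.factorial_succ,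
    smul_eq_mul, pow_one, pow_zero, nsmul_eq_mul, mul_one]
  push_cast
  field_simp

/-- The `n`-th term of the binomial series of `(1 + 5 / 7) ^ (1 / 5)`. -/
noncomputable def binomTerm (n : ℕ) : ℝ := Ring.choose (1 / 5 : ℝ) n * (5 / 7) ^ n

lemma binomTerm_zero : binomTerm 0 = 1 := by simp [binomTerm]

lemma binomTerm_succ (n : ℕ) :
    binomTerm (n + 1) = (1 - 5 * n) / (7 * (n + 1)) * binomTerm n := by
  have hn : (n : ℝ) + 1 ≠ 0 := by positivity
  have h := succ_mul_choose_succ (1 / 5) n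
  unfold binomTerm
  field_simp
  rw [pow_succ]
  linear_combination 5 * (5 / 7 : ℝ) ^ n * h

lemma hasSum_binomTerm : HasSum binomTerm ((12 / 7 : ℝ) ^ ((1 : ℝ) / 5)) := by
  have h := (Real.one_add_rpow_hasFPowerSeriesOnBall_zero (a := 1 / 5)).hasSum
    (y := (5 / 7 : ℝ)) (by
      rw [← ENNReal.ofReal_one, Metric.eball_ofReal, mem_ball_zero_iff]
      norm_num [abs_of_pos])
  simp only [binomialSeries_apply, List.ofFn_const, List.prod_replicate, smul_eq_mul] at h
  rwa [zero_add, show (1 : ℝ) + 5 / 7 = 12 / 7 by norm_num] at h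

lemma abs_binomTerm_le (n : ℕ) : |binomTerm n| ≤ (5 / 7) ^ n := by
  induction n with
  | zero => simp [binomTerm_zero]
  | succ n ih =>
    have hn : (0 : ℝ) ≤ n := n.cast_nonneg
    rw [binomTerm_succ, abs_mul, pow_succ']
    refine mul_le_mul ?_ ih (abs_nonneg _) (by norm_num)
    rw [abs_div, abs_of_pos (a := 7 * ((n : ℝ) + 1)) (by positivity), div_le_iff₀ (by positivity),
      abs_le]
    constructor <;> linarith

lemma tendsto_mul_binomTerm : Tendsto (fun n : ℕ => (n : ℝ) * binomTerm n) atTop (𝓝 0) := by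
  refine squeeze_zero_norm (fun n => ?_)
    (tendsto_self_mul_const_pow_of_lt_one (r := 5 / 7) (by norm_num) (by norm_num))
  rw [norm_mul, Real.norm_natCast, Real.norm_eq_abs]
  exact mul_le_mul_of_nonneg_left (abs_binomTerm_le n) n.cast_nonneg

/-- Closed form of the canonical denominators: `binomDenom A n = B_{n+1}`. -/
noncomputable def binomDenom (A : ℝ) : ℕ → ℝ
  | 0 => 7
  | n + 1 => 7 * (n + 1) * (7 - (12 * n - 1) * A) * binomDenom A n

lemma binomDenom_ne_zero (A : ℤ) (hA : A ≠ -7) (n : ℕ) : binomDenom A n ≠ 0 := by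
  induction n with
  | zero => norm_num [binomDenom]
  | succ n ih =>
    have h : (7 : ℤ) - (12 * n - 1) * A ≠ 0 := by
      intro h
      have hdvd : (12 * (n : ℤ) - 1) ∣ 7 := ⟨A, by linarith⟩
      have hle := Int.le_of_dvd (by norm_num) hdvd
      clear hdvd
      obtain rfl : n = 0 := by omega
      norm_num at h
      omega
    have h' : (7 : ℝ) - (12 * n - 1) * A ≠ 0 := by exact_mod_cast h
    have hn : (n : ℝ) + 1 ≠ 0 := by positivity
    simp only [binomDenom]
    positivity

theorem binomial_example (A : ℤ) (hA : A ≠ -7) (a b : ℕ → ℝ)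
    (ha1 : a 1 = (A : ℝ) + 7)
    (hb1 : b 1 = 7)
    (ha2 : a 2 = 7 * (11 * (A : ℝ) - 7))
    (hb2 : b 2 = -4 * (A : ℝ) + 56)
    (han : ∀ n : ℕ, 3 ≤ n → a n =
      7 * (5 * (n : ℝ) - 11) * ((n : ℝ) - 2) *
        ((12 * (n : ℝ) - 37) * (A : ℝ) - 7) *
        ((12 * (n : ℝ) - 13) * (A : ℝ) - 7))
    (hbn : ∀ n : ℕ, 3 ≤ n → b n =
      -2 * (A : ℝ) * (12 * (n : ℝ) ^ 2 - 31 * (n : ℝ) + 16) +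
        14 * ((n : ℝ) + 2)) :
    Tendsto (fun n : ℕ => cfA 0 a b (n + 1) / cfB 0 a b (n + 1)) atTop
      (nhds ((12 / 7 : ℝ) ^ ((1 : ℝ) / 5))) := by
  have key : ∀ n : ℕ, (cfB 0 a b (n + 2) = binomDenom A n ∧
      cfA 0 a b (n + 2) = binomDenom A n *
        (∑ k ∈ Finset.range (n + 1), binomTerm k + A * (((n + 1 : ℕ) : ℝ) * binomTerm (n + 1)))) ∧
      (cfB 0 a b (n + 3) = binomDenom A (n + 1) ∧
      cfA 0 a b (n + 3) = binomDenom A (n + 1) *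
        (∑ k ∈ Finset.range (n + 2), binomTerm k +
          A * (((n + 2 : ℕ) : ℝ) * binomTerm (n + 2)))) := by
    intro n
    induction n with
    | zero =>
      norm_num [cfA, cfB, ha1, hb1, ha2, hb2, binomDenom, binomTerm_succ, binomTerm_zero,
        Finset.sum_range_succ]
      refine ⟨?_, ?_, ?_⟩ <;> ring
    | succ n ih =>
      obtain ⟨⟨hB, hP⟩, hB', hP'⟩ := ih
      refine ⟨⟨hB', hP'⟩, ?_, ?_⟩
      · rw [cfB, hB, hB', han _ (by omega), hbn _ (by omega)]
        simp only [binomDenom]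
        push_cast
        ring
      · have hterm : ((n : ℝ) + 3) * binomTerm (n + 3) =
            (1 - 5 * (n + 2)) / 7 * binomTerm (n + 2) := by
          rw [binomTerm_succ (n + 2)]
          push_cast
          field_simp
          ring
        rw [cfA, hP, hP', han _ (by omega), hbn _ (by omega)]
        simp only [binomDenom, Finset.sum_range_succ _ (n + 1), Finset.sum_range_succ _ (n + 2)]
        push_cast
        rw [show n + 1 + 2 = n + 3 from rfl, show (n : ℝ) + 1 + 2 = n + 3 by ring, hterm,
          binomTerm_succ (n + 1)]
        push_cast
        field_simp
        ring
  rw [← tendsto_add_atTop_iff_nat 1]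
  have hsum := (tendsto_add_atTop_iff_nat 1).mpr hasSum_binomTerm.tendsto_sum_nat
  have hrem := ((tendsto_add_atTop_iff_nat 1).mpr tendsto_mul_binomTerm).const_mul (A : ℝ)
  have hlim := hsum.add hrem
  rw [mul_zero, add_zero] at hlim
  refine hlim.congr fun n => ?_
  rw [(key n).1.1, (key n).1.2, mul_div_cancel_left₀ _ (binomDenom_ne_zero A hA n)]
end

section
/- (Generalized product-to-continued-fraction transformation) Let (a_i)_{i≥1} be a sequence of real numbers with a_i ≠ 0 for all i ≥ 1 such that the partial products P_n = ∏_{i=1}^n a_i converge to P as n → ∞, and let (b_n)_{n≥0} be a sequence of real numbers with b_n → 1 as n → ∞ and a_i·b_i − b_{i-1} ≠ 0 for all i ≥ 1. Then the continued fraction with constant term b_0 and partial numerators and denominators c_1 = a_1·b_1 − b_0, d_1 = 1; c_2 = −a_1·(a_2·b_2 − b_1), d_2 = a_2·a_1·b_2 − b_0; and for n ≥ 3, c_n = −a_{n-1}·(a_{n-2}·b_{n-2} − b_{n-3})·(a_n·b_n − b_{n-1}), d_n = a_n·a_{n-1}·b_n − b_{n-2}, converges and its limit is P. -/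
open Filter Topology Polynomial

/-- The canonical denominators of the transformed continued fraction telescope into a product. -/
theorem cfB_product_transform (a b c d : ℕ → ℝ)
    (hd1 : d 1 = 1)
    (hc2 : c 2 = -(a 1 * (a 2 * b 2 - b 1)))
    (hd2 : d 2 = a 2 * a 1 * b 2 - b 0)
    (hcn : ∀ n : ℕ, 3 ≤ n → c n =
      -(a (n - 1) * (a (n - 2) * b (n - 2) - b (n - 3)) *
        (a n * b n - b (n - 1))))
    (hdn : ∀ n : ℕ, 3 ≤ n → d n = a n * a (n - 1) * b n - b (n - 2)) (n : ℕ) :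
    cfB (b 0) c d (n + 2) = ∏ i ∈ Finset.range n, (a (i + 1) * b (i + 1) - b i) := by
  induction n using Nat.twoStepInduction with
  | zero => simp [cfB, hd1]
  | one =>
    simp only [cfB, hd1, hc2, hd2, zero_add, Finset.prod_range_one, Nat.reduceAdd]
    ring
  | more n ih₀ ih₁ =>
    have hc := hcn (n + 3) (by omega)
    have hd := hdn (n + 3) (by omega)
    simp only [Nat.add_sub_cancel, show n + 3 - 1 = n + 2 from rfl,
      show n + 3 - 2 = n + 1 from rfl] at hc hd
    rw [show cfB (b 0) c d (n + 2 + 2) = d (n + 3) * cfB (b 0) c d (n + 1 + 2)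
      + c (n + 3) * cfB (b 0) c d (n + 2) from rfl, ih₀, ih₁, hc, hd]
    simp only [Finset.prod_range_succ]
    ring

/-- The canonical numerators of the transformed continued fraction are the denominators times the
weighted partial products. -/
theorem cfA_product_transform (a b c d : ℕ → ℝ)
    (hc1 : c 1 = a 1 * b 1 - b 0)
    (hd1 : d 1 = 1)
    (hc2 : c 2 = -(a 1 * (a 2 * b 2 - b 1)))
    (hd2 : d 2 = a 2 * a 1 * b 2 - b 0)
    (hcn : ∀ n : ℕ, 3 ≤ n → c n =
      -(a (n - 1) * (a (n - 2) * b (n - 2) - b (n - 3)) *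
        (a n * b n - b (n - 1))))
    (hdn : ∀ n : ℕ, 3 ≤ n → d n = a n * a (n - 1) * b n - b (n - 2)) (n : ℕ) :
    cfA (b 0) c d (n + 2) = (∏ i ∈ Finset.range (n + 1), a (i + 1)) * b (n + 1) *
      ∏ i ∈ Finset.range n, (a (i + 1) * b (i + 1) - b i) := by
  induction n using Nat.twoStepInduction with
  | zero => simp [cfA, hc1, hd1]
  | one =>
    simp only [cfA, hc1, hd1, hc2, hd2, zero_add, Finset.prod_range_succ, Finset.prod_range_zero,
      Nat.reduceAdd]
    ring
  | more n ih₀ ih₁ =>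
    have hc := hcn (n + 3) (by omega)
    have hd := hdn (n + 3) (by omega)
    simp only [Nat.add_sub_cancel, show n + 3 - 1 = n + 2 from rfl,
      show n + 3 - 2 = n + 1 from rfl] at hc hd
    rw [show cfA (b 0) c d (n + 2 + 2) = d (n + 3) * cfA (b 0) c d (n + 1 + 2)
      + c (n + 3) * cfA (b 0) c d (n + 2) from rfl, ih₀, ih₁, hc, hd]
    simp only [Finset.prod_range_succ]
    ring

theorem generalized_product_transform (a b c d : ℕ → ℝ) (P : ℝ)
    (ha : ∀ i : ℕ, 1 ≤ i → a i ≠ 0)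
    (hprod : Tendsto (fun n : ℕ => ∏ i ∈ Finset.range n, a (i + 1)) atTop
      (nhds P))
    (hb : Tendsto b atTop (nhds 1))
    (hnz : ∀ i : ℕ, 1 ≤ i → a i * b i - b (i - 1) ≠ 0)
    (hc1 : c 1 = a 1 * b 1 - b 0)
    (hd1 : d 1 = 1)
    (hc2 : c 2 = -(a 1 * (a 2 * b 2 - b 1)))
    (hd2 : d 2 = a 2 * a 1 * b 2 - b 0)
    (hcn : ∀ n : ℕ, 3 ≤ n → c n =
      -(a (n - 1) * (a (n - 2) * b (n - 2) - b (n - 3)) *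
        (a n * b n - b (n - 1))))
    (hdn : ∀ n : ℕ, 3 ≤ n → d n = a n * a (n - 1) * b n - b (n - 2)) :
    Tendsto (fun n : ℕ => cfA (b 0) c d (n + 1) / cfB (b 0) c d (n + 1)) atTop
      (nhds P) := by
  rw [← tendsto_add_atTop_iff_nat 1]
  have hlim := ((tendsto_add_atTop_iff_nat 1).2 hprod).mul ((tendsto_add_atTop_iff_nat 1).2 hb)
  rw [mul_one] at hlim
  refine hlim.congr fun n => ?_
  have hne : ∏ i ∈ Finset.range n, (a (i + 1) * b (i + 1) - b i) ≠ 0 :=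
    Finset.prod_ne_zero_iff.2 fun i _ => hnz (i + 1) (Nat.le_add_left 1 i)
  rw [cfA_product_transform a b c d hc1 hd1 hc2 hd2 hcn hdn,
    cfB_product_transform a b c d hd1 hc2 hd2 hcn hdn, mul_div_cancel_right₀ _ hne]
end

section
/- Let A be an integer. Then the continued fraction with constant term 1 + A and partial numerators and denominators a_1 = −10A − 2, b_1 = 18; a_2 = 2736A + 432, b_2 = −692A − 132; and for n ≥ 3, a_n = 9n(1 − n)(3n − 2)(3n − 4)·((1 + 9A)n + A + 1)·((1 + 9A)n − 17A − 1), b_n = (9n^2 − 1)(9(n−1)^2 − 1)(A + n + 1) − 81n^2(n^2 − 1)(A + n − 1), converges and its limit is 3√3/(2π). -/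
open Filter Topology Polynomial

/-- The partial products of `∏ (1 - 1 / (3 k) ^ 2) = sin (π / 3) / (π / 3)`. -/
noncomputable def sinProd (n : ℕ) : ℝ :=
  ∏ j ∈ Finset.range n, (1 - (1 / 3 : ℝ) ^ 2 / ((j : ℝ) + 1) ^ 2)

theorem sinProd_succ (n : ℕ) :
    sinProd (n + 1) = sinProd n * ((9 * ((n : ℝ) + 1) ^ 2 - 1) / (9 * ((n : ℝ) + 1) ^ 2)) := by
  have h : (n : ℝ) + 1 ≠ 0 := by positivity
  rw [sinProd, Finset.prod_range_succ, ← sinProd]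
  congr 1
  field_simp
  ring

theorem tendsto_sinProd :
    Tendsto sinProd atTop (𝓝 (3 * Real.sqrt 3 / (2 * Real.pi))) := by
  have h := (Real.tendsto_euler_sin_prod (1 / 3)).const_mul (3 / Real.pi)
  have hpi := Real.pi_ne_zero
  rw [mul_one_div, Real.sin_pi_div_three] at h
  convert h using 1
  · funext n
    rw [sinProd]
    field_simp
  · congr 1
    field_simp

/-- The ratio `(n + (9 n - 8) A) (-9 n (n + 1))` of consecutive canonical denominators does not
vanish for `n ≥ 2`. -/
theorem denominator_ratio_ne_zero (A : ℤ) (n : ℕ) :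
    -9 * ((n : ℝ) + 2) * ((n : ℝ) + 3) * ((n : ℝ) + 2 + (9 * (n : ℝ) + 10) * (A : ℝ)) ≠ 0 := by
  have h1 : (n : ℝ) + 2 ≠ 0 := by positivity
  have h2 : (n : ℝ) + 3 ≠ 0 := by positivity
  have h3 : (n : ℤ) + 2 + (9 * (n : ℤ) + 10) * A ≠ 0 := by
    have hn : (0 : ℤ) ≤ n := Int.natCast_nonneg n
    intro h
    rcases le_or_gt 0 A with hA | hA
    · nlinarith [mul_nonneg (by linarith : (0 : ℤ) ≤ 9 * (n : ℤ) + 10) hA]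
    · nlinarith [mul_nonneg (by linarith : (0 : ℤ) ≤ 9 * (n : ℤ) + 10)
        (by linarith : (0 : ℤ) ≤ -1 - A)]
  have h4 : (n : ℝ) + 2 + (9 * (n : ℝ) + 10) * (A : ℝ) ≠ 0 := by exact_mod_cast h3
  exact mul_ne_zero (mul_ne_zero (mul_ne_zero (by norm_num) h1) h2) h4

theorem sin_product_example (A : ℤ) (a b : ℕ → ℝ)
    (ha1 : a 1 = -10 * (A : ℝ) - 2)
    (hb1 : b 1 = 18)
    (ha2 : a 2 = 2736 * (A : ℝ) + 432)
    (hb2 : b 2 = -692 * (A : ℝ) - 132)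
    (han : ∀ n : ℕ, 3 ≤ n → a n =
      9 * (n : ℝ) * (1 - (n : ℝ)) * (3 * (n : ℝ) - 2) * (3 * (n : ℝ) - 4) *
        ((1 + 9 * (A : ℝ)) * (n : ℝ) + (A : ℝ) + 1) *
        ((1 + 9 * (A : ℝ)) * (n : ℝ) - 17 * (A : ℝ) - 1))
    (hbn : ∀ n : ℕ, 3 ≤ n → b n =
      (9 * (n : ℝ) ^ 2 - 1) * (9 * ((n : ℝ) - 1) ^ 2 - 1) *
        ((A : ℝ) + (n : ℝ) + 1) -
        81 * (n : ℝ) ^ 2 * ((n : ℝ) ^ 2 - 1) * ((A : ℝ) + (n : ℝ) - 1)) :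
    Tendsto (fun n : ℕ =>
        cfA (1 + (A : ℝ)) a b (n + 1) / cfB (1 + (A : ℝ)) a b (n + 1)) atTop
      (nhds (3 * Real.sqrt 3 / (2 * Real.pi))) := by
  have hP1 : sinProd 1 = 8 / 9 := by
    rw [sinProd_succ]
    norm_num [sinProd]
  have hP2 : sinProd 2 = 70 / 81 := by
    rw [sinProd_succ, hP1]
    norm_num
  have hB2 : cfB (1 + (A : ℝ)) a b 2 = 18 := by simp [cfB, hb1]
  have hA2 : cfA (1 + (A : ℝ)) a b 2 = 16 + 8 * A := by
    simp only [cfA, zero_add, hb1, ha1]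
    ring
  have key : ∀ n : ℕ,
      cfB (1 + (A : ℝ)) a b (n + 3) =
        -9 * ((n : ℝ) + 2) * ((n : ℝ) + 3) * ((n : ℝ) + 2 + (9 * (n : ℝ) + 10) * (A : ℝ)) *
          cfB (1 + (A : ℝ)) a b (n + 2) ∧
      cfA (1 + (A : ℝ)) a b (n + 2) =
        sinProd (n + 1) * (((n : ℝ) + 2 + A) / ((n : ℝ) + 2)) *
          cfB (1 + (A : ℝ)) a b (n + 2) ∧
      cfA (1 + (A : ℝ)) a b (n + 3) =
        sinProd (n + 2) * (((n : ℝ) + 3 + A) / ((n : ℝ) + 3)) *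
          cfB (1 + (A : ℝ)) a b (n + 3) := by
    intro n
    induction n with
    | zero =>
      have hB3 : cfB (1 + (A : ℝ)) a b 3 = -9720 * A - 1944 := by
        rw [cfB, hB2]
        simp only [cfB, Nat.reduceAdd, hb2, ha2]
        ring
      have hA3 : cfA (1 + (A : ℝ)) a b 3 = 70 / 81 * ((3 + A) / 3) * (-9720 * A - 1944) := by
        rw [cfA, hA2]
        simp only [cfA, Nat.reduceAdd, hb2, ha2]
        ring
      simp only [zero_add, hB3, hA3, hB2, hA2, hP1, hP2, Nat.cast_zero]
      exact ⟨by ring, by ring, trivial⟩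
    | succ n ih =>
      obtain ⟨ihB, ihA, ihA'⟩ := ih
      have ha := han (n + 3) (by omega)
      have hb := hbn (n + 3) (by omega)
      have h2 : (n : ℝ) + 2 ≠ 0 := by positivity
      have h3 : (n : ℝ) + 3 ≠ 0 := by positivity
      have h4 : (n : ℝ) + 4 ≠ 0 := by positivity
      have hB4 : cfB (1 + (A : ℝ)) a b (n + 4) =
          b (n + 3) * cfB (1 + (A : ℝ)) a b (n + 3) +
            a (n + 3) * cfB (1 + (A : ℝ)) a b (n + 2) := rfl
      have hA4 : cfA (1 + (A : ℝ)) a b (n + 4) =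
          b (n + 3) * cfA (1 + (A : ℝ)) a b (n + 3) +
            a (n + 3) * cfA (1 + (A : ℝ)) a b (n + 2) := rfl
      have hP := sinProd_succ (n + 1)
      have hP' := sinProd_succ (n + 2)
      simp only [show n + 1 + 3 = n + 4 from rfl, show n + 1 + 2 = n + 3 from by omega,
        show n + 1 + 1 = n + 2 from rfl] at hP hP' ⊢
      push_cast at ha hb hP hP' ⊢
      have hc2 : (n : ℝ) + 1 + 1 = n + 2 := by ring
      have hc3 : (n : ℝ) + 2 + 1 = n + 3 := by ring
      have hc4 : (n : ℝ) + 1 + 2 = n + 3 := by ring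
      have hc5 : (n : ℝ) + 1 + 3 = n + 4 := by ring
      rw [hc2] at hP
      rw [hc3] at hP'
      rw [hc4, hc5]
      have hB : cfB (1 + (A : ℝ)) a b (n + 4) =
          -9 * ((n : ℝ) + 3) * ((n : ℝ) + 4) *
            ((n : ℝ) + 3 + (9 * ((n : ℝ) + 1) + 10) * (A : ℝ)) *
              cfB (1 + (A : ℝ)) a b (n + 3) := by
        rw [hB4, ha, hb, ihB]
        ring
      refine ⟨hB, ihA', ?_⟩
      rw [hB, hA4, ihA, ihA', hP', hP, ihB, ha, hb]
      field_simp
      ring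
  have hB0 : ∀ n : ℕ, cfB (1 + (A : ℝ)) a b (n + 2) ≠ 0 := by
    intro n
    induction n with
    | zero => simp [hB2]
    | succ n ih =>
      rw [show n + 1 + 2 = n + 3 from by omega, (key n).1]
      exact mul_ne_zero (denominator_ratio_ne_zero A n) ih
  have hfac : Tendsto (fun n : ℕ => ((n : ℝ) + 2 + A) / ((n : ℝ) + 2)) atTop (𝓝 1) := by
    have h : Tendsto (fun n : ℕ => 1 + (A : ℝ) / ((n : ℝ) + 2)) atTop (𝓝 (1 + 0)) :=
      tendsto_const_nhds.add (tendsto_const_nhds.div_atTop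
        (tendsto_atTop_add_const_right _ _ tendsto_natCast_atTop_atTop))
    rw [add_zero] at h
    refine h.congr fun n => ?_
    have h2 : (n : ℝ) + 2 ≠ 0 := by positivity
    field_simp
  rw [← tendsto_add_atTop_iff_nat 1]
  have hlim := ((tendsto_add_atTop_iff_nat 1).2 tendsto_sinProd).mul hfac
  rw [mul_one] at hlim
  refine hlim.congr fun n => ?_
  rw [show n + 1 + 1 = n + 2 from rfl, (key n).2.1, mul_div_cancel_right₀ _ (hB0 n)]
end

section
/- Let (w_n)_{n≥0} be a real sequence with w_0 = 0 and w_n ≠ 0 for all n ≥ 1, and let (a_n)_{n≥1}, (b_n)_{n≥1} be real sequences with a_n − w_{n-1}(b_n + w_n) ≠ 0 for all n ≥ 1. Let A_n, B_n be the canonical numerators and denominators of K_{n=1}^∞ (a_n/b_n) (constant term 0). Define the extended continued fraction (constant term 0) with partial numerators and denominators ã_1 = a_1, b̃_1 = b_1 + w_1; for n ≥ 1, ã_{2n} = −w_n, b̃_{2n} = 1; and for n ≥ 2, ã_{2n-1} = a_n/w_{n-1}, b̃_{2n-1} = b_n + w_n − a_n/w_{n-1}; and let Ã_m, B̃_m be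 its canonical numerators and denominators. Then for every n ≥ 0: Ã_{2n} = A_n, B̃_{2n} = B_n, Ã_{2n+1} = A_{n+1} + w_{n+1}·A_n, and B̃_{2n+1} = B_{n+1} + w_{n+1}·B_n. (That is, the even part of the extended continued fraction is K_{n=1}^∞ (a_n/b_n), and its odd part is the Bauer–Muir transform of K_{n=1}^∞ (a_n/b_n) with respect to (w_n).) -/
open Filter Topology Polynomial

/-- One double step of the extension: if `x` and `y` solve the three-term recurrences of the
extended and of the original continued fraction, the Bauer–Muir relations propagate. -/
theorem bauer_muir_double_step {x₀ x₁ x₂ x₃ y₀ y₁ y₂ v w a b : ℝ} (hv : v ≠ 0)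
    (h₀ : x₀ = y₀) (h₁ : x₁ = y₁ + v * y₀) (hx₂ : x₂ = 1 * x₁ + -v * x₀)
    (hx₃ : x₃ = (b + w - a / v) * x₂ + a / v * x₁) (hy₂ : y₂ = b * y₁ + a * y₀) :
    x₂ = y₁ ∧ x₃ = y₂ + w * y₁ := by
  have h₂ : x₂ = y₁ := by rw [hx₂, h₁, h₀]; ring
  refine ⟨h₂, ?_⟩
  rw [hx₃, h₂, h₁, hy₂]
  field_simp
  ring

theorem extension_bauer_muir (w a b ea eb : ℕ → ℝ)
    (hw0 : w 0 = 0)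
    (hw : ∀ n : ℕ, 1 ≤ n → w n ≠ 0)
    (hnz : ∀ n : ℕ, 1 ≤ n → a n - w (n - 1) * (b n + w n) ≠ 0)
    (hea1 : ea 1 = a 1)
    (heb1 : eb 1 = b 1 + w 1)
    (heae : ∀ n : ℕ, 1 ≤ n → ea (2 * n) = -(w n))
    (hebe : ∀ n : ℕ, 1 ≤ n → eb (2 * n) = 1)
    (heao : ∀ n : ℕ, 2 ≤ n → ea (2 * n - 1) = a n / w (n - 1))
    (hebo : ∀ n : ℕ, 2 ≤ n → eb (2 * n - 1) = b n + w n - a n / w (n - 1)) :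
    ∀ n : ℕ,
      cfA 0 ea eb (2 * n + 1) = cfA 0 a b (n + 1) ∧
      cfB 0 ea eb (2 * n + 1) = cfB 0 a b (n + 1) ∧
      cfA 0 ea eb (2 * n + 2) =
        cfA 0 a b (n + 2) + w (n + 1) * cfA 0 a b (n + 1) ∧
      cfB 0 ea eb (2 * n + 2) =
        cfB 0 a b (n + 2) + w (n + 1) * cfB 0 a b (n + 1) := by
  intro n
  induction n with
  | zero => simp [cfA, cfB, hea1, heb1]
  | succ n ih =>
    obtain ⟨hA₀, hB₀, hA₁, hB₁⟩ := ih
    have hv := hw (n + 1) (by omega)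
    have he : ea (2 * n + 2) = -w (n + 1) := heae (n + 1) (by omega)
    have hf : eb (2 * n + 2) = 1 := hebe (n + 1) (by omega)
    have hg : ea (2 * n + 3) = a (n + 2) / w (n + 1) := heao (n + 2) (by omega)
    have hh : eb (2 * n + 3) = b (n + 2) + w (n + 2) - a (n + 2) / w (n + 1) :=
      hebo (n + 2) (by omega)
    obtain ⟨hA₂, hA₃⟩ := bauer_muir_double_step (x₂ := cfA 0 ea eb (2 * n + 3))
      (x₃ := cfA 0 ea eb (2 * n + 4)) (y₂ := cfA 0 a b (n + 3))
      (w := w (n + 2)) (b := b (n + 2)) hv hA₀ hA₁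
      (by rw [← he, ← hf, cfA]) (by rw [← hh, ← hg, cfA]) (by rw [cfA])
    obtain ⟨hB₂, hB₃⟩ := bauer_muir_double_step (x₂ := cfB 0 ea eb (2 * n + 3))
      (x₃ := cfB 0 ea eb (2 * n + 4)) (y₂ := cfB 0 a b (n + 3))
      (w := w (n + 2)) (b := b (n + 2)) hv hB₀ hB₁
      (by rw [← he, ← hf, cfB]) (by rw [← hh, ← hg, cfB]) (by rw [cfB])
    exact ⟨hA₂, hB₂, hA₃, hB₃⟩
end

section
/- Let a, b be real polynomials with a(n) > 0 and b(n) > 0 for all integers n ≥ 1, and let w : ℕ → ℝ be given by a rational function (a quotient of real polynomials with nonvanishing denominator on ℕ) with w_n > 0 for all n ≥ 1 and w_0 = 0, and suppose a(n) − w_{n-1}(b(n) + w_n) ≠ 0 for all n ≥ 1. Let A_n, B_n be the canonical numerators and denominators of K_{n=1}^∞ (a(n)/b(n)) (constant term 0). If A_n/B_n → L as n → ∞, then (A_n + w_n·A_{n-1})/(B_n + w_n·B_{n-1}) → L as n → ∞; that is, the Bauer–Muir transform of K_{n=1}^∞ (a(n)/b(n)) with respect to (w_n) converges to the same limit. -/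
open Filter Topology Polynomial

theorem cfB_succ_pos (b₀ : ℝ) {a b : ℕ → ℝ} (ha : ∀ n, 1 ≤ n → 0 < a n)
    (hb : ∀ n, 1 ≤ n → 0 < b n) (n : ℕ) : 0 < cfB b₀ a b (n + 1) := by
  have key : ∀ n, 0 ≤ cfB b₀ a b n ∧ 0 < cfB b₀ a b (n + 1) := by
    intro n
    induction n with
    | zero => simp [cfB]
    | succ k ih =>
      refine ⟨ih.2.le, ?_⟩
      rw [cfB]
      have h₁ := mul_pos (hb (k + 1) (by omega)) ih.2
      have h₂ := mul_nonneg (ha (k + 1) (by omega)).le ih.1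
      linarith
  exact (key n).2

/-- A weighted mediant of two fractions with positive denominators lies between them. -/
theorem weighted_mediant_mem_Icc {x y p q w : ℝ} (hp : 0 < p) (hq : 0 < q) (hw : 0 ≤ w) :
    (x + w * y) / (p + w * q) ∈ Set.Icc (min (x / p) (y / q)) (max (x / p) (y / q)) := by
  have hd : 0 < p + w * q := by positivity
  constructor
  · rw [le_div_iff₀ hd]
    have h₁ := (le_div_iff₀ hp).1 (min_le_left (x / p) (y / q))
    have h₂ := (le_div_iff₀ hq).1 (min_le_right (x / p) (y / q))
    nlinarith [mul_le_mul_of_nonneg_left h₂ hw]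
  · rw [div_le_iff₀ hd]
    have h₁ := (div_le_iff₀ hp).1 (le_max_left (x / p) (y / q))
    have h₂ := (div_le_iff₀ hq).1 (le_max_right (x / p) (y / q))
    nlinarith [mul_le_mul_of_nonneg_left h₂ hw]

/-- Weighted mediants of consecutive terms of a convergent sequence of fractions with positive
denominators converge to the same limit. -/
theorem tendsto_weighted_mediant {A B w : ℕ → ℝ} {L : ℝ} (hB : ∀ n, 0 < B (n + 1))
    (hw : ∀ n, 1 ≤ n → 0 ≤ w n)
    (h : Tendsto (fun n => A (n + 1) / B (n + 1)) atTop (𝓝 L)) :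
    Tendsto (fun n => (A (n + 1) + w n * A n) / (B (n + 1) + w n * B n)) atTop (𝓝 L) := by
  rw [← tendsto_add_atTop_iff_nat 1]
  have h' := h.comp (tendsto_add_atTop_nat 1)
  have hmin := h'.min h
  have hmax := h'.max h
  rw [min_self] at hmin
  rw [max_self] at hmax
  have hmem (n : ℕ) := weighted_mediant_mem_Icc (x := A (n + 1 + 1)) (y := A (n + 1))
    (hB (n + 1)) (hB n) (hw (n + 1) (by omega))
  exact tendsto_of_tendsto_of_tendsto_of_le_of_le hmin hmax
    (fun n => (hmem n).1) (fun n => (hmem n).2)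

theorem bauer_muir_same_limit (a b : Polynomial ℝ) (w : ℕ → ℝ) (L : ℝ)
    (hapos : ∀ n : ℕ, 1 ≤ n → 0 < a.eval (n : ℝ))
    (hbpos : ∀ n : ℕ, 1 ≤ n → 0 < b.eval (n : ℝ))
    (hw : ∃ p q : Polynomial ℝ, (∀ n : ℕ, q.eval (n : ℝ) ≠ 0) ∧
      ∀ n : ℕ, w n = p.eval (n : ℝ) / q.eval (n : ℝ))
    (hwpos : ∀ n : ℕ, 1 ≤ n → 0 < w n)
    (hw0 : w 0 = 0)
    (hnz : ∀ n : ℕ, 1 ≤ n →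
      a.eval (n : ℝ) - w (n - 1) * (b.eval (n : ℝ) + w n) ≠ 0)
    (hlim : Tendsto (fun n : ℕ =>
        cfA 0 (fun m => a.eval (m : ℝ)) (fun m => b.eval (m : ℝ)) (n + 1) /
          cfB 0 (fun m => a.eval (m : ℝ)) (fun m => b.eval (m : ℝ)) (n + 1))
      atTop (nhds L)) :
    Tendsto (fun n : ℕ =>
        (cfA 0 (fun m => a.eval (m : ℝ)) (fun m => b.eval (m : ℝ)) (n + 1) +
            w n * cfA 0 (fun m => a.eval (m : ℝ)) (fun m => b.eval (m : ℝ)) n) /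
          (cfB 0 (fun m => a.eval (m : ℝ)) (fun m => b.eval (m : ℝ)) (n + 1) +
            w n * cfB 0 (fun m => a.eval (m : ℝ)) (fun m => b.eval (m : ℝ)) n))
      atTop (nhds L) := by
  exact tendsto_weighted_mediant (cfB_succ_pos 0 hapos hbpos) (fun n hn => (hwpos n hn).le) hlim
end

section
/- Let A be a non-negative integer. Then the continued fraction with constant term 2 and partial numerators and denominators a_1 = 1, b_1 = 1 + A; a_2 = 1 − 2A(1 + A), b_2 = 2(1 + A); a_3 = 2(1 − 3A(1 + A)), b_3 = 3 − 5A − 6A^2; and for n ≥ 4, a_n = (n − 1)·(1 − nA(1 + A))·(1 − (n − 2)A(1 + A)), b_n = n − (n(n−1) − 1)A − n(n−1)A^2, converges and its limit is e (Euler's number). -/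
open Filter Topology Polynomial

/-- The common factor `∏_{j=2}^{n+1} (1 - j A (1 + A))` of the canonical numerators and
denominators of index `n + 2`. -/
noncomputable def cfFactor (A : ℝ) (n : ℕ) : ℝ :=
  ∏ j ∈ Finset.range n, (1 - ((j : ℝ) + 2) * A * (1 + A))

lemma cfFactor_succ (A : ℝ) (n : ℕ) :
    cfFactor A (n + 1) = cfFactor A n * (1 - ((n : ℝ) + 2) * A * (1 + A)) := by
  simp [cfFactor, Finset.prod_range_succ]

lemma cfFactor_natCast_ne_zero (A n : ℕ) : cfFactor A n ≠ 0 := by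
  refine Finset.prod_ne_zero_iff.mpr fun j _ => ?_
  rcases Nat.eq_zero_or_pos A with rfl | hA
  · simp
  · have hA' : (1 : ℝ) ≤ A := by exact_mod_cast hA
    have hj : (0 : ℝ) ≤ j := j.cast_nonneg
    have h : (1 : ℝ) < ((j : ℝ) + 2) * A * (1 + A) := by
      have h₁ : (2 : ℝ) ≤ ((j : ℝ) + 2) * A := by nlinarith
      nlinarith
    linarith

lemma numDerangements_succ_real (n : ℕ) :
    (numDerangements (n + 1) : ℝ) = ((n : ℝ) + 1) * numDerangements n - (-1) ^ n := by
  exact_mod_cast numDerangements_succ n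

/-- Two solutions of the same three-term recurrence that agree at the first two indices are
equal. -/
lemma eq_of_three_term_recurrence {u w p q : ℕ → ℝ}
    (hu : ∀ n, u (n + 2) = p n * u (n + 1) + q n * u n)
    (hw : ∀ n, w (n + 2) = p n * w (n + 1) + q n * w n)
    (h0 : u 0 = w 0) (h1 : u 1 = w 1) (n : ℕ) : u n = w n := by
  induction n using Nat.twoStepInduction with
  | zero => exact h0
  | one => exact h1
  | more n ih₀ ih₁ => rw [hu, hw, ih₀, ih₁]

theorem e_cf_family (A : ℕ) (a b : ℕ → ℝ)
    (ha1 : a 1 = 1)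
    (hb1 : b 1 = 1 + (A : ℝ))
    (ha2 : a 2 = 1 - 2 * (A : ℝ) * (1 + (A : ℝ)))
    (hb2 : b 2 = 2 * (1 + (A : ℝ)))
    (ha3 : a 3 = 2 * (1 - 3 * (A : ℝ) * (1 + (A : ℝ))))
    (hb3 : b 3 = 3 - 5 * (A : ℝ) - 6 * (A : ℝ) ^ 2)
    (han : ∀ n : ℕ, 4 ≤ n → a n =
      ((n : ℝ) - 1) * (1 - (n : ℝ) * (A : ℝ) * (1 + (A : ℝ))) *
        (1 - ((n : ℝ) - 2) * (A : ℝ) * (1 + (A : ℝ))))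
    (hbn : ∀ n : ℕ, 4 ≤ n → b n =
      (n : ℝ) - ((n : ℝ) * ((n : ℝ) - 1) - 1) * (A : ℝ) -
        (n : ℝ) * ((n : ℝ) - 1) * (A : ℝ) ^ 2) :
    Tendsto (fun n : ℕ => cfA 2 a b (n + 1) / cfB 2 a b (n + 1)) atTop
      (nhds (Real.exp 1)) := by
  have ha4 : ∀ n : ℕ, a (n + 4) = ((n : ℝ) + 3) * (1 - ((n : ℝ) + 4) * A * (1 + A)) *
      (1 - ((n : ℝ) + 2) * A * (1 + A)) := fun n => by
    rw [han (n + 4) (by omega)]; push_cast; ring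
  have hb4 : ∀ n : ℕ, b (n + 4) = ((n : ℝ) + 4) - (((n : ℝ) + 4) * ((n : ℝ) + 3) - 1) * A -
      ((n : ℝ) + 4) * ((n : ℝ) + 3) * (A : ℝ) ^ 2 := fun n => by
    rw [hbn (n + 4) (by omega)]; push_cast; ring
  have hnum : ∀ n : ℕ, cfA 2 a b (n + 3) =
      cfFactor A n * ((n + 2).factorial * ((n : ℝ) + 4 + ((n : ℝ) + 3) * A)) := by
    refine eq_of_three_term_recurrence (fun _ => rfl) (fun n => ?_) ?_ ?_
    · rw [ha4, hb4, cfFactor_succ, cfFactor_succ, Nat.factorial_succ (n + 3),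
        Nat.factorial_succ (n + 2)]
      push_cast
      ring
    · simp [cfA, cfFactor, ha1, ha2, hb1, hb2, Nat.factorial]
      ring
    · simp [cfA, cfFactor, ha1, ha2, ha3, hb1, hb2, hb3, Nat.factorial]
      ring
  have hden : ∀ n : ℕ, cfB 2 a b (n + 3) =
      cfFactor A n * (((n : ℝ) + 4 + ((n : ℝ) + 3) * A) * numDerangements (n + 2) -
        (-1) ^ n * (1 + A)) := by
    refine eq_of_three_term_recurrence (fun _ => rfl) (fun n => ?_) ?_ ?_
    · rw [ha4, hb4, cfFactor_succ, cfFactor_succ, numDerangements_succ_real (n + 3),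
        numDerangements_succ_real (n + 2)]
      push_cast
      ring
    · simp [cfB, cfFactor, ha1, ha2, hb1, hb2, numDerangements]
      ring
    · simp [cfB, cfFactor, ha1, ha2, ha3, hb1, hb2, hb3, numDerangements]
      ring
  have hpos : ∀ n : ℕ, (0 : ℝ) < (n : ℝ) + 4 + ((n : ℝ) + 3) * A := fun n => by positivity
  have hquot : ∀ n : ℕ, cfA 2 a b (n + 3) / cfB 2 a b (n + 3) =
      ((numDerangements (n + 2) : ℝ) / (n + 2).factorial -
        (-1) ^ n * (1 + A) / ((n + 2).factorial * ((n : ℝ) + 4 + ((n : ℝ) + 3) * A)))⁻¹ := by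
    intro n
    have hf : ((n + 2).factorial : ℝ) ≠ 0 := by positivity
    rw [hnum, hden, mul_div_mul_left _ _ (cfFactor_natCast_ne_zero A n), ← inv_div]
    congr 1
    have := (hpos n).ne'
    field_simp
  have herr : Tendsto (fun n : ℕ => (-1 : ℝ) ^ n * (1 + A) /
      ((n + 2).factorial * ((n : ℝ) + 4 + ((n : ℝ) + 3) * A))) atTop (𝓝 0) := by
    refine squeeze_zero_norm (fun n => ?_) (tendsto_one_div_add_atTop_nhds_zero_nat (𝕜 := ℝ))
    have hf : (1 : ℝ) ≤ (n + 2).factorial := by exact_mod_cast (n + 2).factorial_pos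
    have hp := hpos n
    have hd : (0 : ℝ) < (n + 2).factorial * ((n : ℝ) + 4 + ((n : ℝ) + 3) * A) := by positivity
    rw [norm_div, norm_mul, norm_pow, norm_neg, norm_one, one_pow, one_mul, Real.norm_eq_abs,
      Real.norm_eq_abs, abs_of_pos hd, abs_of_nonneg (by positivity),
      div_le_div_iff₀ hd (by positivity)]
    have hA : (0 : ℝ) ≤ A := A.cast_nonneg
    calc (1 + (A : ℝ)) * (n + 1) ≤ 1 * ((n : ℝ) + 4 + ((n : ℝ) + 3) * A) := by nlinarith
      _ ≤ (n + 2).factorial * ((n : ℝ) + 4 + ((n : ℝ) + 3) * A) := by gcongr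
      _ = _ := (one_mul _).symm
  have hlim := (((tendsto_add_atTop_iff_nat 2).mpr numDerangements_tendsto_inv_e).sub herr).inv₀
    (by simp)
  rw [sub_zero, ← Real.exp_neg, neg_neg] at hlim
  exact (tendsto_add_atTop_iff_nat 2).mp (hlim.congr fun n => (hquot n).symm)
end
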